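/- Assume 1/4 < s' ≤ 1, 1/2 < s ≤ 1, max(3/2 − 2s, s/2 − 1/8) < s' < 4s − 3/2, 1/2 < θ₀ < 3/4, and max(1/2, 1 − s') < θ₁ < min(3/4, 4s − s' − 1, 2s − 1/2). Then there exists ε₀ > 0 such that for every ε with 0 < ε ≤ ε₀ there exists a constant C > 0 such that for all Schwartz functions u, v on ℝ^{1+2} and all j, k ∈ {1,2}: (∫_{ℝ×ℝ²} |ξ|^{−2} (1+|ξ|²)^{s'−1} (1+||τ|−|ξ||)^{2(θ₁−1+ε)} |F[Q_{jk}(u,v)](τ,ξ)|² dτ dξ)^{1/2} ≤ C ‖u‖_{H^{s,θ₀}} ‖v‖_{H^{s,θ₀}}. -/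

import Mathlib

open MeasureTheory Real
open scoped FourierTransform

noncomputable section

/-- Space-time ℝ^{1+2}: coordinate 0 is time `t`, coordinates 1,2 are space `x₁, x₂`. -/
abbrev SpaceTime := EuclideanSpace ℝ (Fin 3)

/-- The magnitude `|ξ|` of the spatial part of a frequency point `(τ, ξ) ∈ ℝ × ℝ²`. -/
def spFreq (ζ : SpaceTime) : ℝ := Real.sqrt ((ζ 1) ^ 2 + (ζ 2) ^ 2)

/-- The wave-Sobolev norm
`‖u‖_{H^{s,b}} = (∫ (1+|ξ|²)^s (1+||τ|-|ξ||)^{2b} |û(τ,ξ)|² dτ dξ)^{1/2}`. -/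
def waveNorm (s b : ℝ) (f : SpaceTime → ℂ) : ℝ :=
  (∫ ζ : SpaceTime, (1 + (spFreq ζ) ^ 2) ^ s * (1 + |(|ζ 0| - spFreq ζ)|) ^ (2 * b) *
    ‖𝓕 f ζ‖ ^ 2) ^ (1/2 : ℝ)

/-- Partial derivative in the `i`-th coordinate direction. -/
def pd (i : Fin 3) (f : SpaceTime → ℂ) (x : SpaceTime) : ℂ :=
  fderiv ℝ f x (EuclideanSpace.single i 1)

/-- The null form `Q_{jk}(u,v) = ∂_j u ∂_k v − ∂_k u ∂_j v`. -/
def nullForm (j k : Fin 3) (u v : SpaceTime → ℂ) (x : SpaceTime) : ℂ :=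
  pd j u x * pd k v x - pd k u x * pd j v x

/-! ### Plane geometry and bipolar coordinates -/

/-- The Euclidean length of a vector of `ℝ × ℝ`. -/
def planeNorm (x : ℝ × ℝ) : ℝ := √(x.1 ^ 2 + x.2 ^ 2)

/-- The cross product of two vectors of `ℝ × ℝ`. -/
def planeCross (x y : ℝ × ℝ) : ℝ := x.1 * y.2 - x.2 * y.1

lemma planeNorm_nonneg (x : ℝ × ℝ) : 0 ≤ planeNorm x := Real.sqrt_nonneg _

lemma planeNorm_sq (x : ℝ × ℝ) : planeNorm x ^ 2 = x.1 ^ 2 + x.2 ^ 2 :=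
  Real.sq_sqrt (by positivity)

lemma planeNorm_neg (x : ℝ × ℝ) : planeNorm (-x) = planeNorm x := by
  simp [planeNorm]

@[fun_prop]
lemma continuous_planeNorm : Continuous planeNorm := by
  unfold planeNorm; fun_prop

@[fun_prop]
lemma measurable_planeNorm : Measurable planeNorm := continuous_planeNorm.measurable

lemma planeNorm_pos {x y : ℝ × ℝ} (h : planeCross x y ≠ 0) : 0 < planeNorm x := by
  refine Real.sqrt_pos.2 ?_
  by_contra! h'
  have h1 : x.1 = 0 := by nlinarith [sq_nonneg x.1, sq_nonneg x.2]
  have h2 : x.2 = 0 := by nlinarith [sq_nonneg x.1, sq_nonneg x.2]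
  simp [planeCross, h1, h2] at h

lemma planeCross_sq (x y : ℝ × ℝ) :
    planeCross x y ^ 2 =
      ((planeNorm x + planeNorm y) ^ 2 - planeNorm (x + y) ^ 2) *
        (planeNorm (x + y) ^ 2 - (planeNorm x - planeNorm y) ^ 2) / 4 := by
  have hx := planeNorm_sq x
  have hy := planeNorm_sq y
  have hxy := planeNorm_sq (x + y)
  simp only [Prod.fst_add, Prod.snd_add] at hxy
  have h1 : (planeNorm x + planeNorm y) ^ 2 - planeNorm (x + y) ^ 2 =
      2 * (planeNorm x * planeNorm y) - 2 * (x.1 * y.1 + x.2 * y.2) := by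
    linear_combination hx + hy - hxy
  have h2 : planeNorm (x + y) ^ 2 - (planeNorm x - planeNorm y) ^ 2 =
      2 * (planeNorm x * planeNorm y) + 2 * (x.1 * y.1 + x.2 * y.2) := by
    linear_combination -hx - hy + hxy
  rw [h1, h2, planeCross]
  linear_combination (-planeNorm y ^ 2) * hx - (x.1 ^ 2 + x.2 ^ 2) * hy

/-- The bipolar coordinates of a point with respect to the foci `0` and `-η`. -/
def bipolar (η ξ : ℝ × ℝ) : ℝ × ℝ := (planeNorm ξ, planeNorm (ξ + η))

/-- The derivative of `bipolar η` off the line through the foci. -/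
def fderivBipolar (η ξ : ℝ × ℝ) : ℝ × ℝ →L[ℝ] ℝ × ℝ :=
  (Matrix.toLin (.finTwoProd ℝ) (.finTwoProd ℝ)
    !![ξ.1 / planeNorm ξ, ξ.2 / planeNorm ξ;
      (ξ + η).1 / planeNorm (ξ + η), (ξ + η).2 / planeNorm (ξ + η)]).toContinuousLinearMap

lemma planeCross_add_self (ξ η : ℝ × ℝ) : planeCross (ξ + η) η = planeCross ξ η := by
  simp only [planeCross, Prod.fst_add, Prod.snd_add]; ring

lemma planeCross_comm (x y : ℝ × ℝ) : planeCross y x = -planeCross x y := by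
  simp only [planeCross]; ring

lemma det_fderivBipolar (η ξ : ℝ × ℝ) :
    (fderivBipolar η ξ).det = planeCross ξ η / (planeNorm ξ * planeNorm (ξ + η)) := by
  unfold fderivBipolar
  simp only [LinearMap.det_toContinuousLinearMap, LinearMap.det_toLin, Matrix.det_fin_two_of]
  rw [div_mul_div_comm, div_mul_div_comm, ← sub_div, planeCross]
  simp only [Prod.fst_add, Prod.snd_add]
  congr 1
  ring

lemma hasFDerivAt_planeNorm {ξ : ℝ × ℝ} (h : 0 < planeNorm ξ) :
    HasFDerivAt planeNorm ((ξ.1 / planeNorm ξ) • ContinuousLinearMap.fst ℝ ℝ ℝ +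
      (ξ.2 / planeNorm ξ) • ContinuousLinearMap.snd ℝ ℝ ℝ) ξ := by
  have h0 : ξ.1 ^ 2 + ξ.2 ^ 2 ≠ 0 := (Real.sqrt_pos.1 h).ne'
  have := (((hasFDerivAt_fst (𝕜 := ℝ) (p := ξ)).pow 2).add
    ((hasFDerivAt_snd (𝕜 := ℝ) (p := ξ)).pow 2)).sqrt h0
  refine this.congr_fderiv ?_
  ext <;> simp [planeNorm] <;> field_simp

lemma hasFDerivAt_bipolar {η ξ : ℝ × ℝ} (h : planeCross ξ η ≠ 0) :
    HasFDerivAt (bipolar η) (fderivBipolar η ξ) ξ := by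
  have h1 : 0 < planeNorm ξ := planeNorm_pos h
  have h2 : 0 < planeNorm (ξ + η) := planeNorm_pos (y := η) (by rwa [planeCross_add_self])
  have h3 := (hasFDerivAt_planeNorm h2).comp ξ ((hasFDerivAt_id ξ).add_const η)
  refine ((hasFDerivAt_planeNorm h1).prodMk h3).congr_fderiv ?_
  unfold fderivBipolar
  rw [Matrix.toLin_finTwoProd_toContinuousLinearMap]
  ext <;> simp

lemma bipolar_injOn {η : ℝ × ℝ} {s : Set (ℝ × ℝ)}
    (hs : (∀ ξ ∈ s, 0 < planeCross ξ η) ∨ ∀ ξ ∈ s, planeCross ξ η < 0) :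
    Set.InjOn (bipolar η) s := by
  intro x hx y hy hxy
  have h1 : planeNorm x ^ 2 = planeNorm y ^ 2 :=
    congrArg (fun p : ℝ × ℝ => p.1 ^ 2) hxy
  have h2 : planeNorm (x + η) ^ 2 = planeNorm (y + η) ^ 2 :=
    congrArg (fun p : ℝ × ℝ => p.2 ^ 2) hxy
  simp only [planeNorm_sq, Prod.fst_add, Prod.snd_add] at h1 h2
  have hdot : x.1 * η.1 + x.2 * η.2 = y.1 * η.1 + y.2 * η.2 := by linarith
  have hsq : planeCross x η ^ 2 = planeCross y η ^ 2 := by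
    simp only [planeCross]
    linear_combination (η.1 ^ 2 + η.2 ^ 2) * h1 -
      (x.1 * η.1 + x.2 * η.2 + (y.1 * η.1 + y.2 * η.2)) * hdot
  have hcr : planeCross x η = planeCross y η := by
    rcases hs with hs | hs
    · exact (pow_left_inj₀ (hs x hx).le (hs y hy).le two_ne_zero).1 hsq
    · have := (pow_left_inj₀ (neg_nonneg.2 (hs x hx).le) (neg_nonneg.2 (hs y hy).le)
        two_ne_zero).1 (by simpa using hsq)
      linarith
  have hne : planeCross x η ≠ 0 := by
    rcases hs with hs | hs
    · exact (hs x hx).ne'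
    · exact (hs x hx).ne
  have hη : 0 < η.1 ^ 2 + η.2 ^ 2 := by
    have := planeNorm_pos (x := η) (y := x) (by rwa [planeCross_comm, neg_ne_zero])
    exact Real.sqrt_pos.1 this
  simp only [planeCross] at hcr
  refine Prod.ext ?_ ?_
  · refine mul_right_cancel₀ hη.ne' ?_
    linear_combination η.1 * hdot + η.2 * hcr
  · refine mul_right_cancel₀ hη.ne' ?_
    linear_combination η.2 * hdot - η.1 * hcr

lemma measurable_planeCross (η : ℝ × ℝ) : Measurable (planeCross · η) := by
  unfold planeCross; fun_prop

/-- Integration in bipolar coordinates: the Jacobian `|ξ| |ξ + η| / |ξ × η|` is cancelled by the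
weight. -/
lemma lintegral_bipolar_le (η : ℝ × ℝ) (H : ℝ × ℝ → ENNReal) :
    ∫⁻ ξ, ENNReal.ofReal (|planeCross ξ η| / (planeNorm ξ * planeNorm (ξ + η))) *
      H (bipolar η ξ) ≤ 2 * ∫⁻ p in Set.Ioi 0 ×ˢ Set.Ioi 0, H p := by
  have key : ∀ s : Set (ℝ × ℝ), MeasurableSet s →
      ((∀ ξ ∈ s, 0 < planeCross ξ η) ∨ ∀ ξ ∈ s, planeCross ξ η < 0) →
      ∫⁻ ξ in s, ENNReal.ofReal (|planeCross ξ η| / (planeNorm ξ * planeNorm (ξ + η))) *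
        H (bipolar η ξ) ≤ ∫⁻ p in Set.Ioi 0 ×ˢ Set.Ioi 0, H p := by
    intro s hs hsign
    have hne : ∀ ξ ∈ s, planeCross ξ η ≠ 0 := fun ξ hξ => by
      rcases hsign with h | h
      · exact (h ξ hξ).ne'
      · exact (h ξ hξ).ne
    have himg := lintegral_image_eq_lintegral_abs_det_fderiv_mul volume hs
      (fun ξ hξ => (hasFDerivAt_bipolar (hne ξ hξ)).hasFDerivWithinAt) (bipolar_injOn hsign) H
    calc _ = ∫⁻ ξ in s, ENNReal.ofReal |(fderivBipolar η ξ).det| * H (bipolar η ξ) := by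
          refine lintegral_congr fun ξ => ?_
          rw [det_fderivBipolar, abs_div, abs_mul, abs_of_nonneg (planeNorm_nonneg ξ),
            abs_of_nonneg (planeNorm_nonneg (ξ + η))]
      _ = ∫⁻ p in bipolar η '' s, H p := himg.symm
      _ ≤ _ := by
          refine lintegral_mono_set ?_
          rintro _ ⟨ξ, hξ, rfl⟩
          exact ⟨planeNorm_pos (hne ξ hξ),
            planeNorm_pos (y := η) (by rw [planeCross_add_self]; exact hne ξ hξ)⟩
  have hm := measurable_planeCross η
  have hpos : MeasurableSet {ξ | 0 < planeCross ξ η} := measurableSet_lt measurable_const hm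
  have hneg : MeasurableSet {ξ | planeCross ξ η < 0} := measurableSet_lt hm measurable_const
  have hzero : MeasurableSet {ξ | planeCross ξ η = 0} := measurableSet_eq_fun hm measurable_const
  have huniv : (Set.univ : Set (ℝ × ℝ)) =
      {ξ | planeCross ξ η = 0} ∪ ({ξ | 0 < planeCross ξ η} ∪ {ξ | planeCross ξ η < 0}) := by
    ext ξ
    rcases lt_trichotomy (planeCross ξ η) 0 with h | h | h <;> simp [h]
  rw [← setLIntegral_univ, huniv]
  refine (lintegral_union_le _ _ _).trans ?_
  have h0 : ∫⁻ ξ in {ξ | planeCross ξ η = 0},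
      ENNReal.ofReal (|planeCross ξ η| / (planeNorm ξ * planeNorm (ξ + η))) *
        H (bipolar η ξ) = 0 := by
    rw [setLIntegral_congr_fun (g := fun _ => 0) hzero (fun ξ (hξ : planeCross ξ η = 0) => by
      simp [hξ])]
    simp
  rw [h0, zero_add, two_mul]
  exact (lintegral_union_le _ _ _).trans
    (add_le_add (key _ hpos (Or.inl fun _ h => h)) (key _ hneg (Or.inr fun _ h => h)))

/-! ### Cauchy–Schwarz and one-dimensional integrals -/

lemma lintegral_mul_sq_le {α : Type*} [MeasurableSpace α] (μ : Measure α) {f g : α → ENNReal}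
    (hf : AEMeasurable f μ) (hg : AEMeasurable g μ) :
    (∫⁻ x, f x * g x ∂μ) ^ 2 ≤ (∫⁻ x, f x ^ 2 ∂μ) * ∫⁻ x, g x ^ 2 ∂μ := by
  have h := ENNReal.lintegral_mul_le_Lp_mul_Lq μ Real.HolderConjugate.two_two hf hg
  simp only [Pi.mul_apply, ENNReal.rpow_two] at h
  refine (pow_le_pow_left' h 2).trans_eq ?_
  rw [mul_pow, ← ENNReal.rpow_two, ← ENNReal.rpow_two, ← ENNReal.rpow_mul, ← ENNReal.rpow_mul]
  norm_num

/-- The weight `(1 + |x|)⁻ᵖ`. -/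
def decay (p x : ℝ) : ENNReal := ENNReal.ofReal ((1 + |x|) ^ (-p))

@[fun_prop]
lemma measurable_decay (p : ℝ) : Measurable (decay p) := by
  unfold decay; fun_prop

lemma decay_neg (p x : ℝ) : decay p (-x) = decay p x := by simp [decay]

/-- The total mass of `decay p`. -/
def decayMass (p : ℝ) : ENNReal := ∫⁻ x, decay p x

lemma decayMass_lt_top {p : ℝ} (hp : 1 < p) : decayMass p < ⊤ := by
  have := finite_integral_one_add_norm (μ := (volume : Measure ℝ)) (r := p) (by simpa using hp)
  simpa [decayMass, decay, Real.norm_eq_abs] using this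

lemma lintegral_decay_sub (p c : ℝ) : ∫⁻ x, decay p (x - c) = decayMass p :=
  lintegral_sub_right_eq_self (decay p) c

lemma lintegral_decay_sub' (p c : ℝ) : ∫⁻ x, decay p (c - x) = decayMass p :=
  lintegral_sub_left_eq_self (decay p) c

lemma lintegral_decay_abs_sub_le (p c : ℝ) : ∫⁻ x, decay p (|x| - c) ≤ 2 * decayMass p := by
  calc ∫⁻ x, decay p (|x| - c) ≤ ∫⁻ x, (decay p (x - c) + decay p (-c - x)) := by
        refine lintegral_mono fun x => ?_
        rcases abs_choice x with h | h
        · rw [h]; exact le_self_add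
        · rw [h, sub_eq_neg_add, ← sub_eq_add_neg]; exact le_add_self
    _ = 2 * decayMass p := by
        rw [lintegral_add_left (by fun_prop), lintegral_decay_sub, lintegral_decay_sub', two_mul]

lemma lintegral_decay_abs_add_sub_le (p a c : ℝ) :
    ∫⁻ x, decay p (|x + a| - c) ≤ 2 * decayMass p :=
  (lintegral_add_right_eq_self (fun x => decay p (|x| - c)) a).trans_le
    (lintegral_decay_abs_sub_le p c)

/-- An integrable weight on the half-line, comparable to `t ^ (-1/2)` near the origin. -/
def halfDecay (δ t : ℝ) : ENNReal := ENNReal.ofReal (t ^ (-1/2 : ℝ) * (1 + t) ^ (-1/2 - δ))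

@[fun_prop]
lemma measurable_halfDecay (δ : ℝ) : Measurable (halfDecay δ) := by
  unfold halfDecay; fun_prop

lemma lintegral_halfDecay_lt_top {δ : ℝ} (hδ : 0 < δ) :
    ∫⁻ t in Set.Ioi 0, halfDecay δ t < ⊤ := by
  have hsplit : Set.Ioi (0 : ℝ) = Set.Ioc 0 1 ∪ Set.Ioi 1 :=
    (Set.Ioc_union_Ioi_eq_Ioi zero_le_one).symm
  rw [hsplit]
  refine (lintegral_union_le _ _ _).trans_lt (ENNReal.add_lt_top.2 ⟨?_, ?_⟩)
  · have h1 : IntegrableOn (fun t : ℝ => t ^ (-1/2 : ℝ)) (Set.Ioc 0 1) := by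
      have := intervalIntegral.intervalIntegrable_rpow' (a := 0) (b := 1)
        (show (-1 : ℝ) < -1/2 by norm_num)
      exact (intervalIntegrable_iff_integrableOn_Ioc_of_le zero_le_one).1 this
    refine lt_of_le_of_lt ?_ h1.lintegral_lt_top
    refine setLIntegral_mono' measurableSet_Ioc fun t ht => ENNReal.ofReal_le_ofReal ?_
    have : (1 + t) ^ (-1/2 - δ) ≤ 1 :=
      Real.rpow_le_one_of_one_le_of_nonpos (by linarith [ht.1]) (by linarith)
    exact mul_le_of_le_one_right (Real.rpow_nonneg ht.1.le _) this
  · have h1 : IntegrableOn (fun t : ℝ => t ^ (-1 - δ)) (Set.Ioi 1) :=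
      integrableOn_Ioi_rpow_of_lt (by linarith) one_pos
    refine lt_of_le_of_lt ?_ h1.lintegral_lt_top
    refine setLIntegral_mono' measurableSet_Ioi fun t (ht : 1 < t) => ENNReal.ofReal_le_ofReal ?_
    have ht0 : 0 < t := by linarith
    calc t ^ (-1/2 : ℝ) * (1 + t) ^ (-1/2 - δ) ≤ t ^ (-1/2 : ℝ) * t ^ (-1/2 - δ) := by
          refine mul_le_mul_of_nonneg_left ?_ (by positivity)
          exact Real.rpow_le_rpow_of_nonpos ht0 (by linarith) (by linarith)
      _ = t ^ (-1 - δ) := by rw [← Real.rpow_add ht0]; congr 1; ring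

/-! ### Trilinear forms on frequency triples with zero sum -/

lemma sq_lintegral_le_of_sq_le {α : Type*} [MeasurableSpace α] {μ : Measure α}
    {f g h : α → ENNReal} (hg : AEMeasurable g μ) (hh : AEMeasurable h μ)
    (hfgh : ∀ x, f x ^ 2 ≤ g x * h x) :
    (∫⁻ x, f x ∂μ) ^ 2 ≤ (∫⁻ x, g x ∂μ) * ∫⁻ x, h x ∂μ := by
  have hroot : ∀ y : ENNReal, (y ^ (1/2 : ℝ)) ^ 2 = y := fun y => by
    rw [← ENNReal.rpow_two, ← ENNReal.rpow_mul]; norm_num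
  have hle : ∀ x, f x ≤ g x ^ (1/2 : ℝ) * h x ^ (1/2 : ℝ) := fun x => by
    have := ENNReal.rpow_le_rpow (hfgh x) (show (0 : ℝ) ≤ 1/2 by norm_num)
    rw [← ENNReal.rpow_two, ← ENNReal.rpow_mul,
      ENNReal.mul_rpow_of_nonneg _ _ (by norm_num)] at this
    simpa using this
  refine (pow_le_pow_left' (lintegral_mono hle) 2).trans ?_
  refine (lintegral_mul_sq_le μ (hg.pow_const _) (hh.pow_const _)).trans_eq ?_
  simp only [hroot]

/-- Frequency space `ℝ × ℝ²`, with points `(τ, ξ)`. -/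
abbrev Freq := ℝ × (ℝ × ℝ)

/-- The signed distance `|τ| - |ξ|` to the light cone. -/
def modulation (ζ : Freq) : ℝ := |ζ.1| - planeNorm ζ.2

@[fun_prop]
lemma measurable_modulation : Measurable modulation := by
  unfold modulation; fun_prop

instance : (volume : Measure Freq).IsAddHaarMeasure := Measure.prod.instIsAddHaarMeasure _ _

/-- The integral over all triples with zero sum. -/
def zeroSumLIntegral (Φ : Freq → Freq → Freq → ENNReal) : ENNReal :=
  ∫⁻ x, ∫⁻ y, Φ (-x - y) x y

lemma zeroSumLIntegral_swap_right {Φ : Freq → Freq → Freq → ENNReal}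
    (hΦ : Measurable fun p : Freq × Freq × Freq => Φ p.1 p.2.1 p.2.2) :
    zeroSumLIntegral (fun x y z => Φ x z y) = zeroSumLIntegral Φ := by
  unfold zeroSumLIntegral
  rw [lintegral_lintegral_swap]
  · refine lintegral_congr fun y => lintegral_congr fun x => ?_
    rw [show -x - y = -y - x by abel]
  · exact (hΦ.comp (f := fun p : Freq × Freq => (-p.1 - p.2, p.2, p.1))
      (by fun_prop)).aemeasurable

lemma zeroSumLIntegral_swap_left {Φ : Freq → Freq → Freq → ENNReal}
    (hΦ : Measurable fun p : Freq × Freq × Freq => Φ p.1 p.2.1 p.2.2) :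
    zeroSumLIntegral (fun x y z => Φ y x z) = zeroSumLIntegral Φ := by
  have h1 : Measurable fun p : Freq × Freq => Φ p.1 (-p.1 - p.2) p.2 :=
    hΦ.comp (f := fun p : Freq × Freq => (p.1, -p.1 - p.2, p.2)) (by fun_prop)
  have h2 : Measurable fun p : Freq × Freq => Φ (-p.1 - p.2) p.1 p.2 :=
    hΦ.comp (f := fun p : Freq × Freq => (-p.1 - p.2, p.1, p.2)) (by fun_prop)
  calc ∫⁻ x, ∫⁻ y, Φ x (-x - y) y = ∫⁻ y, ∫⁻ x, Φ x (-x - y) y :=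
        lintegral_lintegral_swap h1.aemeasurable
    _ = ∫⁻ y, ∫⁻ x, Φ (-x - y) x y := by
        refine lintegral_congr fun y => ?_
        rw [← lintegral_sub_left_eq_self _ (-y)]
        refine lintegral_congr fun x => ?_
        rw [show -(-y - x) - y = x by abel, show -x - y = -y - x by abel]
    _ = _ := (lintegral_lintegral_swap h2.aemeasurable).symm

/-- A kernel `κ` is admissible when the trilinear form with kernel `κ ^ (1/2)` is bounded on
`L² × L² × L²`; the three functions are represented by their squares. -/
structure IsAdmissible (κ : Freq → Freq → Freq → ENNReal) : Prop where
  measurable : Measurable fun p : Freq × Freq × Freq => κ p.1 p.2.1 p.2.2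
  bound : ∃ C : ENNReal, C ≠ ⊤ ∧ ∀ A B D : Freq → ENNReal, Measurable A → Measurable B →
    Measurable D → zeroSumLIntegral (fun x y z => (κ x y z * (A x * B y * D z)) ^ (1/2 : ℝ)) ^ 2 ≤
      C * ((∫⁻ x, A x) * (∫⁻ x, B x) * ∫⁻ x, D x)

namespace IsAdmissible

lemma measurable_integrand {κ : Freq → Freq → Freq → ENNReal}
    (hκ : Measurable fun p : Freq × Freq × Freq => κ p.1 p.2.1 p.2.2) {A B D : Freq → ENNReal}
    (hA : Measurable A) (hB : Measurable B) (hD : Measurable D) :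
    Measurable fun p : Freq × Freq × Freq =>
      (κ p.1 p.2.1 p.2.2 * (A p.1 * B p.2.1 * D p.2.2)) ^ (1/2 : ℝ) := by
  fun_prop

lemma swap_right {κ : Freq → Freq → Freq → ENNReal} (h : IsAdmissible κ) :
    IsAdmissible fun x y z => κ x z y := by
  obtain ⟨C, hC, hb⟩ := h.bound
  refine ⟨h.measurable.comp (f := fun p : Freq × Freq × Freq => (p.1, p.2.2, p.2.1))
    (by fun_prop), C, hC, fun A B D hA hB hD => ?_⟩
  have := zeroSumLIntegral_swap_right (Φ := fun x y z => (κ x y z * (A x * D y * B z)) ^ (1/2 : ℝ))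
    (measurable_integrand h.measurable hA hD hB)
  calc _ = zeroSumLIntegral
        (fun x y z => (κ x z y * (A x * D z * B y)) ^ (1/2 : ℝ)) ^ 2 := by
        simp only [mul_right_comm]
    _ = _ := by rw [this]
    _ ≤ _ := (hb A D B hA hD hB).trans_eq (by ring)

lemma swap_left {κ : Freq → Freq → Freq → ENNReal} (h : IsAdmissible κ) :
    IsAdmissible fun x y z => κ y x z := by
  obtain ⟨C, hC, hb⟩ := h.bound
  refine ⟨h.measurable.comp (f := fun p : Freq × Freq × Freq => (p.2.1, p.1, p.2.2))
    (by fun_prop), C, hC, fun A B D hA hB hD => ?_⟩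
  have := zeroSumLIntegral_swap_left (Φ := fun x y z => (κ x y z * (B x * A y * D z)) ^ (1/2 : ℝ))
    (measurable_integrand h.measurable hB hA hD)
  calc _ = zeroSumLIntegral
        (fun x y z => (κ y x z * (B y * A x * D z)) ^ (1/2 : ℝ)) ^ 2 := by
        simp only [mul_comm]
    _ = _ := by rw [this]
    _ ≤ _ := (hb B A D hB hA hD).trans_eq (by ring)

lemma add {κ κ' : Freq → Freq → Freq → ENNReal} (h : IsAdmissible κ) (h' : IsAdmissible κ') :
    IsAdmissible fun x y z => κ x y z + κ' x y z := by
  obtain ⟨C, hC, hb⟩ := h.bound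
  obtain ⟨C', hC', hb'⟩ := h'.bound
  refine ⟨h.measurable.add h'.measurable, 4 * (C + C'), by finiteness, fun A B D hA hB hD => ?_⟩
  have hm := measurable_integrand h.measurable hA hB hD
  have hsum : zeroSumLIntegral
      (fun x y z => ((κ x y z + κ' x y z) * (A x * B y * D z)) ^ (1/2 : ℝ)) ≤
      zeroSumLIntegral (fun x y z => (κ x y z * (A x * B y * D z)) ^ (1/2 : ℝ)) +
      zeroSumLIntegral (fun x y z => (κ' x y z * (A x * B y * D z)) ^ (1/2 : ℝ)) := by
    have hm2 : Measurable fun p : Freq × Freq => (κ (-p.1 - p.2) p.1 p.2 *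
        (A (-p.1 - p.2) * B p.1 * D p.2)) ^ (1/2 : ℝ) :=
      hm.comp (f := fun p : Freq × Freq => (-p.1 - p.2, p.1, p.2)) (by fun_prop)
    unfold zeroSumLIntegral
    rw [← lintegral_add_left hm2.lintegral_prod_right']
    refine lintegral_mono fun x => ?_
    have hx : Measurable fun y => (κ (-x - y) x y * (A (-x - y) * B x * D y)) ^ (1/2 : ℝ) :=
      hm2.comp measurable_prodMk_left
    beta_reduce
    rw [← lintegral_add_left hx]
    refine lintegral_mono fun y => ?_
    rw [add_mul]
    exact ENNReal.rpow_add_le_add_rpow _ _ (by norm_num) (by norm_num)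
  have hsq : ∀ a b : ENNReal, (a + b) ^ 2 ≤ 4 * (a ^ 2 + b ^ 2) := fun a b => by
    rcases le_total a b with hab | hab
    · calc (a + b) ^ 2 ≤ (b + b) ^ 2 := by gcongr
        _ = 4 * b ^ 2 := by ring
        _ ≤ _ := by gcongr; exact le_add_self
    · calc (a + b) ^ 2 ≤ (a + a) ^ 2 := by gcongr
        _ = 4 * a ^ 2 := by ring
        _ ≤ _ := by gcongr; exact le_self_add
  calc _ ≤ _ := pow_le_pow_left' hsum 2
    _ ≤ _ := hsq _ _
    _ ≤ 4 * (C * ((∫⁻ x, A x) * (∫⁻ x, B x) * ∫⁻ x, D x) +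
        C' * ((∫⁻ x, A x) * (∫⁻ x, B x) * ∫⁻ x, D x)) := by
        gcongr
        · exact hb A B D hA hB hD
        · exact hb' A B D hA hB hD
    _ = _ := by ring

lemma of_lintegral_le {κ : Freq → Freq → Freq → ENNReal}
    (hm : Measurable fun p : Freq × Freq × Freq => κ p.1 p.2.1 p.2.2) {C : ENNReal} (hC : C ≠ ⊤)
    (h : ∀ y, ∫⁻ x, κ (-x - y) x y ≤ C) : IsAdmissible κ := by
  refine ⟨hm, C, hC, fun A B D hA hB hD => ?_⟩
  have hmκ : Measurable fun p : Freq × Freq => κ (-p.1 - p.2) p.1 p.2 :=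
    hm.comp (f := fun p : Freq × Freq => (-p.1 - p.2, p.1, p.2)) (by fun_prop)
  have hAB : Measurable fun p : Freq × Freq => A (-p.2 - p.1) * B p.2 := by fun_prop
  unfold zeroSumLIntegral
  rw [lintegral_lintegral_swap]
  swap
  · exact (hmκ.mul (by fun_prop : Measurable fun p : Freq × Freq =>
      A (-p.1 - p.2) * B p.1 * D p.2)).pow_const _ |>.aemeasurable
  have hstep := sq_lintegral_le_of_sq_le (μ := volume)
    (f := fun y => ∫⁻ x, (κ (-x - y) x y * (A (-x - y) * B x * D y)) ^ (1/2 : ℝ))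
    (g := fun y => D y) (h := fun y => C * ∫⁻ x, A (-x - y) * B x) hD.aemeasurable
    (hAB.lintegral_prod_right'.const_mul C).aemeasurable fun y => ?_
  · refine hstep.trans_eq ?_
    rw [lintegral_const_mul _ hAB.lintegral_prod_right', lintegral_lintegral_swap hAB.aemeasurable]
    have : ∀ x, ∫⁻ y, A (-x - y) * B x = (∫⁻ y, A y) * B x := fun x => by
      rw [lintegral_mul_const _ (by fun_prop), lintegral_sub_left_eq_self A (-x)]
    simp_rw [this]
    rw [lintegral_const_mul _ hB]
    ring
  · have := sq_lintegral_le_of_sq_le (μ := volume)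
      (f := fun x => (κ (-x - y) x y * (A (-x - y) * B x * D y)) ^ (1/2 : ℝ))
      (g := fun x => κ (-x - y) x y) (h := fun x => A (-x - y) * B x * D y)
      (hmκ.comp measurable_prodMk_right).aemeasurable (by fun_prop) fun x => by
        rw [← ENNReal.rpow_two, ← ENNReal.rpow_mul]; norm_num
    refine this.trans ?_
    rw [lintegral_mul_const _ (by fun_prop)]
    calc _ ≤ C * ((∫⁻ x, A (-x - y) * B x) * D y) := by gcongr; exact h y
      _ = _ := by ring

end IsAdmissible

/-! ### The model kernels -/

/-- The null-form weight `|ξ × η| / (|ξ| |ξ'|)`. -/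
def crossWeight (x y z : ℝ × ℝ) : ENNReal :=
  ENNReal.ofReal (|planeCross x y| / (planeNorm x * planeNorm z))

@[fun_prop]
lemma measurable_crossWeight {α : Type*} [MeasurableSpace α] {f g h : α → ℝ × ℝ}
    (hf : Measurable f) (hg : Measurable g) (hh : Measurable h) :
    Measurable fun a => crossWeight (f a) (g a) (h a) := by
  unfold crossWeight planeCross; fun_prop

lemma lintegral_crossWeight_le (η : ℝ × ℝ) {G : ℝ → ℝ → ℝ → ENNReal}
    (hG : Measurable fun p : ℝ × ℝ × ℝ => G p.1 p.2.1 p.2.2) :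
    ∫⁻ x : Freq, crossWeight x.2 η (x.2 + η) * G x.1 (planeNorm x.2) (planeNorm (x.2 + η)) ≤
      2 * ∫⁻ τ, ∫⁻ ρ, ∫⁻ t in Set.Ioi 0, G τ ρ t := by
  have hm : Measurable fun x : Freq =>
      crossWeight x.2 η (x.2 + η) * G x.1 (planeNorm x.2) (planeNorm (x.2 + η)) :=
    Measurable.mul (by fun_prop)
      (hG.comp (f := fun x : Freq => (x.1, planeNorm x.2, planeNorm (x.2 + η))) (by fun_prop))
  rw [Measure.volume_eq_prod, lintegral_prod _ hm.aemeasurable,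
    ← lintegral_const_mul' _ _ (by simp)]
  refine lintegral_mono fun τ => ?_
  refine (lintegral_bipolar_le η (fun p => G τ p.1 p.2)).trans ?_
  gcongr
  have hmτ : Measurable fun p : ℝ × ℝ => G τ p.1 p.2 := hG.comp measurable_prodMk_left
  rw [Measure.volume_eq_prod, setLIntegral_prod _ hmτ.aemeasurable]
  exact setLIntegral_le_lintegral _ _

lemma planeNorm_neg_sub (x y : Freq) : planeNorm (-x - y).2 = planeNorm (x.2 + y.2) := by
  rw [show (-x - y).2 = -(x.2 + y.2) by simp; abel, planeNorm_neg]

lemma crossWeight_neg_sub (x y : Freq) (η : ℝ × ℝ) :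
    crossWeight x.2 η (-x - y).2 = crossWeight x.2 η (x.2 + y.2) := by
  rw [crossWeight, crossWeight, planeNorm_neg_sub]

/-- The model kernel for a dominant modulation at high frequency. -/
def highKernel (b δ : ℝ) (x y z : Freq) : ENNReal :=
  crossWeight y.2 z.2 x.2 *
    (halfDecay δ (planeNorm x.2) * (decay b (modulation x) * decay b (modulation y)))

lemma isAdmissible_highKernel {b δ : ℝ} (hb : 1 < b) (hδ : 0 < δ) :
    IsAdmissible (highKernel b δ) := by
  have hM := (decayMass_lt_top hb).ne
  have hH := (lintegral_halfDecay_lt_top hδ).ne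
  refine IsAdmissible.of_lintegral_le (by unfold highKernel; fun_prop)
    (C := 2 * ((∫⁻ t in Set.Ioi 0, halfDecay δ t) * (decayMass b * (2 * decayMass b))))
    (by finiteness) fun y => ?_
  set G : ℝ → ℝ → ℝ → ENNReal := fun τ ρ t =>
    halfDecay δ t * (decay b (|τ + y.1| - t) * decay b (|τ| - ρ)) with hG
  have hGm : Measurable fun p : ℝ × ℝ × ℝ => G p.1 p.2.1 p.2.2 := by fun_prop
  calc ∫⁻ x, highKernel b δ (-x - y) x y
      = ∫⁻ x : Freq, crossWeight x.2 y.2 (x.2 + y.2) *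
          G x.1 (planeNorm x.2) (planeNorm (x.2 + y.2)) := by
        refine lintegral_congr fun x => ?_
        rw [highKernel, crossWeight_neg_sub, modulation, modulation, planeNorm_neg_sub, hG]
        rw [show (-x - y).1 = -(x.1 + y.1) by simp; ring, abs_neg]
    _ ≤ _ := lintegral_crossWeight_le y.2 hGm
    _ ≤ _ := by
        gcongr
        calc ∫⁻ τ, ∫⁻ ρ, ∫⁻ t in Set.Ioi 0, G τ ρ t
            = ∫⁻ τ, ∫⁻ t in Set.Ioi 0, ∫⁻ ρ, G τ ρ t := by
              refine lintegral_congr fun τ => lintegral_lintegral_swap ?_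
              exact (hGm.comp measurable_prodMk_left).aemeasurable
          _ = ∫⁻ τ, ∫⁻ t in Set.Ioi 0,
                halfDecay δ t * (decay b (|τ + y.1| - t) * decayMass b) := by
              simp only [hG]
              refine lintegral_congr fun τ => lintegral_congr fun t => ?_
              rw [lintegral_const_mul _ (by fun_prop), lintegral_const_mul _ (by fun_prop),
                lintegral_decay_sub']
          _ = ∫⁻ t in Set.Ioi 0, ∫⁻ τ,
                halfDecay δ t * (decay b (|τ + y.1| - t) * decayMass b) :=
              lintegral_lintegral_swap (by fun_prop)
          _ ≤ ∫⁻ t in Set.Ioi 0, halfDecay δ t * (decayMass b * (2 * decayMass b)) := by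
              refine lintegral_mono fun t => ?_
              rw [lintegral_const_mul _ (by fun_prop), lintegral_mul_const _ (by fun_prop),
                mul_comm (decayMass b)]
              gcongr
              exact lintegral_decay_abs_add_sub_le b y.1 t
          _ = _ := lintegral_mul_const _ (by fun_prop)

/-- The model kernel for a dominant modulation at low frequency, close to the cone. -/
def lowKernel (p b δ : ℝ) (x y z : Freq) : ENNReal :=
  crossWeight y.2 z.2 x.2 * (halfDecay δ (planeNorm x.2) *
    (decay p (planeNorm x.2 - |planeNorm y.2 - planeNorm z.2|) * decay b (modulation y)))

lemma isAdmissible_lowKernel {p b δ : ℝ} (hp : 1 < p) (hb : 1 < b) (hδ : 0 < δ) :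
    IsAdmissible (lowKernel p b δ) := by
  have hM := (decayMass_lt_top hb).ne
  have hM' := (decayMass_lt_top hp).ne
  have hH := (lintegral_halfDecay_lt_top hδ).ne
  refine IsAdmissible.of_lintegral_le (by unfold lowKernel; fun_prop)
    (C := 2 * ((∫⁻ t in Set.Ioi 0, halfDecay δ t) * (2 * decayMass p * (2 * decayMass b))))
    (by finiteness) fun y => ?_
  set r := planeNorm y.2
  set G : ℝ → ℝ → ℝ → ENNReal := fun τ ρ t =>
    halfDecay δ t * (decay p (t - |ρ - r|) * decay b (|τ| - ρ)) with hG
  have hGm : Measurable fun p : ℝ × ℝ × ℝ => G p.1 p.2.1 p.2.2 := by fun_prop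
  calc ∫⁻ x, lowKernel p b δ (-x - y) x y
      = ∫⁻ x : Freq, crossWeight x.2 y.2 (x.2 + y.2) *
          G x.1 (planeNorm x.2) (planeNorm (x.2 + y.2)) := by
        refine lintegral_congr fun x => ?_
        rw [lowKernel, crossWeight_neg_sub, modulation, planeNorm_neg_sub]
    _ ≤ _ := lintegral_crossWeight_le y.2 hGm
    _ ≤ _ := by
        gcongr
        calc ∫⁻ τ, ∫⁻ ρ, ∫⁻ t in Set.Ioi 0, G τ ρ t
            = ∫⁻ ρ, ∫⁻ τ, ∫⁻ t in Set.Ioi 0, G τ ρ t := by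
              refine lintegral_lintegral_swap (Measurable.aemeasurable ?_)
              refine Measurable.lintegral_prod_right' (f := fun q : (ℝ × ℝ) × ℝ => G q.1.1 q.1.2 q.2)
                ?_
              exact hGm.comp (f := fun q : (ℝ × ℝ) × ℝ => (q.1.1, q.1.2, q.2)) (by fun_prop)
          _ = ∫⁻ ρ, ∫⁻ t in Set.Ioi 0, ∫⁻ τ, G τ ρ t := by
              refine lintegral_congr fun ρ => lintegral_lintegral_swap ?_
              exact (hGm.comp (f := fun q : ℝ × ℝ => (q.1, ρ, q.2)) (by fun_prop)).aemeasurable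
          _ ≤ ∫⁻ ρ, ∫⁻ t in Set.Ioi 0,
                halfDecay δ t * (decay p (t - |ρ - r|) * (2 * decayMass b)) := by
              simp only [hG]
              refine lintegral_mono fun ρ => lintegral_mono fun t => ?_
              rw [lintegral_const_mul _ (by fun_prop), lintegral_const_mul _ (by fun_prop)]
              gcongr
              exact lintegral_decay_abs_sub_le b ρ
          _ = ∫⁻ t in Set.Ioi 0, ∫⁻ ρ,
                halfDecay δ t * (decay p (t - |ρ - r|) * (2 * decayMass b)) :=
              lintegral_lintegral_swap (by fun_prop)
          _ ≤ ∫⁻ t in Set.Ioi 0, halfDecay δ t * (2 * decayMass p * (2 * decayMass b)) := by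
              refine lintegral_mono fun t => ?_
              rw [lintegral_const_mul _ (by fun_prop), lintegral_mul_const _ (by fun_prop)]
              gcongr
              calc ∫⁻ ρ, decay p (t - |ρ - r|) = ∫⁻ ρ, decay p (|ρ + -r| - t) := by
                    refine lintegral_congr fun ρ => ?_
                    rw [← decay_neg, neg_sub, sub_eq_add_neg ρ]
                _ ≤ _ := lintegral_decay_abs_add_sub_le p (-r) t
          _ = _ := lintegral_mul_const _ (by fun_prop)

/-- The indicator of `|ρ - r| ≤ 1`. -/
def window (r ρ : ℝ) : ENNReal := (Set.Icc (-1) 1).indicator 1 (r - ρ)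

@[fun_prop]
lemma measurable_window {α : Type*} [MeasurableSpace α] {f g : α → ℝ}
    (hf : Measurable f) (hg : Measurable g) : Measurable fun a => window (f a) (g a) :=
  (measurable_one.indicator measurableSet_Icc).comp (hf.sub hg)

lemma lintegral_window_left (ρ : ℝ) : ∫⁻ r, window r ρ = 2 := by
  unfold window
  rw [lintegral_sub_right_eq_self (fun r => (Set.Icc (-1 : ℝ) 1).indicator (1 : ℝ → ENNReal) r) ρ,
    lintegral_indicator_one measurableSet_Icc, Real.volume_Icc]
  norm_num

lemma lintegral_window_right (r : ℝ) : ∫⁻ ρ, window r ρ = 2 := by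
  unfold window
  rw [lintegral_sub_left_eq_self (fun r => (Set.Icc (-1 : ℝ) 1).indicator (1 : ℝ → ENNReal) r) r,
    lintegral_indicator_one measurableSet_Icc, Real.volume_Icc]
  norm_num

lemma window_rpow_half_mul_decay_le {p : ℝ} (hp : 0 ≤ p) (r ρ σ : ℝ) (K : ENNReal) :
    window r ρ * (decay p (ρ - σ) * K) ^ (1/2 : ℝ) ≤
      (window r ρ * (ENNReal.ofReal (2 ^ p) * decay p (r - σ) * K)) ^ (1/2 : ℝ) := by
  by_cases h : r - ρ ∈ Set.Icc (-1 : ℝ) 1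
  · have hw : window r ρ = 1 := by simp only [window, Set.indicator_of_mem h, Pi.one_apply]
    rw [hw, one_mul, one_mul]
    gcongr
    rw [decay, decay, ← ENNReal.ofReal_mul (by positivity)]
    refine ENNReal.ofReal_le_ofReal ?_
    have h1 : 1 + |r - σ| ≤ 2 * (1 + |ρ - σ|) := by
      have : |r - σ| ≤ |r - ρ| + |ρ - σ| := by
        simpa using abs_add_le (r - ρ) (ρ - σ)
      have h2 : |r - ρ| ≤ 1 := abs_le.2 h
      have := abs_nonneg (ρ - σ)
      linarith
    have h3 := Real.rpow_le_rpow_of_nonpos (by positivity : (0:ℝ) < 1 + |r - σ|) h1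
      (neg_nonpos.2 hp)
    rw [Real.mul_rpow (by positivity) (by positivity), Real.rpow_neg (by positivity)] at h3
    calc _ = 2 ^ p * ((2 ^ p)⁻¹ * (1 + |ρ - σ|) ^ (-p)) := by
          rw [mul_inv_cancel_left₀ (by positivity)]
      _ ≤ _ := by gcongr
  · have hw : window r ρ = 0 := by simp only [window, Set.indicator_of_notMem h]
    simp [hw]

/-- The model kernel for a dominant modulation at low frequency, away from the cone. -/
def diagKernel (p b : ℝ) (_x y z : Freq) : ENNReal :=
  decay p (planeNorm y.2 - planeNorm z.2) *
    (crossWeight y.2 z.2 z.2 * (decay b (modulation y) * decay b (modulation z)))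

lemma crossWeight_neg_sub_right (x y : Freq) (ζ : ℝ × ℝ) :
    crossWeight y.2 (-x - y).2 ζ = crossWeight y.2 x.2 ζ := by
  have h : planeCross y.2 (-x - y).2 = -planeCross y.2 x.2 := by
    simp only [planeCross, Prod.snd_sub, Prod.snd_neg, Prod.fst_sub, Prod.fst_neg]
    ring
  rw [crossWeight, crossWeight, h, abs_neg]

lemma lintegral_diagKernel_window_le (b r : ℝ) (x : Freq) :
    ∫⁻ y : Freq, window r (planeNorm y.2) * (crossWeight y.2 (-x - y).2 (-x - y).2 *
      (decay b (modulation y) * decay b (modulation (-x - y)))) ≤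
      2 * (2 * (2 * decayMass b * decayMass b)) := by
  set G : ℝ → ℝ → ℝ → ENNReal := fun τ ρ t =>
    window r ρ * (decay b (|τ| - ρ) * decay b (|x.1 + τ| - t)) with hG
  have hGm : Measurable fun p : ℝ × ℝ × ℝ => G p.1 p.2.1 p.2.2 := by fun_prop
  calc _ = ∫⁻ y : Freq, crossWeight y.2 x.2 (y.2 + x.2) *
          G y.1 (planeNorm y.2) (planeNorm (y.2 + x.2)) := by
        refine lintegral_congr fun y => ?_
        rw [crossWeight_neg_sub_right, crossWeight, crossWeight, modulation, modulation,
          planeNorm_neg_sub, add_comm y.2, hG, show (-x - y).1 = -(x.1 + y.1) by simp; ring,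
           abs_neg]
        ring
    _ ≤ _ := lintegral_crossWeight_le x.2 hGm
    _ ≤ _ := by
        gcongr
        calc ∫⁻ τ, ∫⁻ ρ, ∫⁻ t in Set.Ioi 0, G τ ρ t
            ≤ ∫⁻ τ, ∫⁻ ρ, ∫⁻ t, G τ ρ t :=
              lintegral_mono fun τ => lintegral_mono fun ρ => setLIntegral_le_lintegral _ _
          _ = ∫⁻ τ, ∫⁻ ρ, window r ρ * (decay b (|τ| - ρ) * decayMass b) := by
              refine lintegral_congr fun τ => lintegral_congr fun ρ => ?_
              rw [lintegral_const_mul _ (by fun_prop), lintegral_const_mul _ (by fun_prop),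
                lintegral_decay_sub']
          _ = ∫⁻ ρ, ∫⁻ τ, window r ρ * (decay b (|τ| - ρ) * decayMass b) :=
              lintegral_lintegral_swap (by fun_prop)
          _ ≤ ∫⁻ ρ, window r ρ * (2 * decayMass b * decayMass b) := by
              refine lintegral_mono fun ρ => ?_
              rw [lintegral_const_mul _ (by fun_prop), lintegral_mul_const _ (by fun_prop)]
              gcongr
              exact lintegral_decay_abs_sub_le b ρ
          _ = _ := by rw [lintegral_mul_const _ (by fun_prop), lintegral_window_right]

lemma isAdmissible_diagKernel {p b : ℝ} (hp : 1 < p) (hb : 1 < b) :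
    IsAdmissible (diagKernel p b) := by
  have hM := (decayMass_lt_top hb).ne
  have hM' := (decayMass_lt_top hp).ne
  set c := ENNReal.ofReal (2 ^ p) with hc
  refine ⟨by unfold diagKernel; fun_prop,
    2 * (2 * (2 * decayMass b * decayMass b)) * (c * 2 * decayMass p),
    by simp only [hc]; finiteness, fun A B D hA hB hD => ?_⟩
  -- the part of the kernel without the weight in `|ξ| - |η|`
  set κ : Freq → Freq → ENNReal := fun y z =>
    crossWeight y.2 z.2 z.2 * (decay b (modulation y) * decay b (modulation z)) with hκ
  have hκm : Measurable fun q : Freq × Freq => κ q.1 q.2 := by simp only [hκ]; fun_prop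
  set f : ℝ → ENNReal := fun r => ∫⁻ q : Freq × Freq, (window r (planeNorm q.1.2) *
    (c * decay p (r - planeNorm q.2.2) * (κ q.1 q.2 * (A (-q.1 - q.2) * B q.1 * D q.2))))
      ^ (1/2 : ℝ)
    with hf
  have hsum : zeroSumLIntegral
      (fun x y z => (diagKernel p b x y z * (A x * B y * D z)) ^ (1/2 : ℝ)) ≤ ∫⁻ r, f r := by
    calc _ = ∫⁻ q : Freq × Freq,
          (decay p (planeNorm q.1.2 - planeNorm q.2.2) *
            (κ q.1 q.2 * (A (-q.1 - q.2) * B q.1 * D q.2))) ^ (1/2 : ℝ) := by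
          rw [Measure.volume_eq_prod (Freq) (Freq), lintegral_prod _ (by fun_prop)]
          unfold zeroSumLIntegral
          refine lintegral_congr fun y => lintegral_congr fun z => ?_
          simp only [diagKernel, hκ, mul_assoc]
      _ ≤ ∫⁻ q : Freq × Freq, ∫⁻ r, (window r (planeNorm q.1.2) *
            (c * decay p (r - planeNorm q.2.2) *
              (κ q.1 q.2 * (A (-q.1 - q.2) * B q.1 * D q.2)))) ^ (1/2 : ℝ) := by
          refine lintegral_mono fun q => ?_
          refine le_trans ?_ (lintegral_mono fun r =>
            window_rpow_half_mul_decay_le (by linarith : 0 ≤ p) r _ _ _)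
          rw [lintegral_mul_const _ (by fun_prop), lintegral_window_left]
          exact le_mul_of_one_le_left' one_le_two
      _ = _ := lintegral_lintegral_swap (by fun_prop)
  refine (pow_le_pow_left' hsum 2).trans ?_
  have hwB : Measurable fun q : ℝ × Freq => window q.1 (planeNorm q.2.2) * B q.2 := by fun_prop
  have hwD : Measurable fun q : ℝ × Freq => decay p (q.1 - planeNorm q.2.2) * D q.2 := by fun_prop
  have hfr : ∀ r, f r ^ 2 ≤
      (2 * (2 * (2 * decayMass b * decayMass b)) * (∫⁻ x, A x) * c *
        ∫⁻ y : Freq, window r (planeNorm y.2) * B y) *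
      ∫⁻ z : Freq, decay p (r - planeNorm z.2) * D z := by
    intro r
    have hwin : ∀ ρ, window r ρ * window r ρ = window r ρ := fun ρ => by
      simp only [window, Set.indicator]; split_ifs <;> simp
    have h1 := sq_lintegral_le_of_sq_le (μ := (volume : Measure (Freq × Freq)))
      (f := fun q => (window r (planeNorm q.1.2) *
        (c * decay p (r - planeNorm q.2.2) *
          (κ q.1 q.2 * (A (-q.1 - q.2) * B q.1 * D q.2)))) ^ (1/2 : ℝ))
      (g := fun q => A (-q.1 - q.2) * (window r (planeNorm q.1.2) * κ q.1 q.2))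
      (h := fun q => window r (planeNorm q.1.2) * B q.1 *
        (c * (decay p (r - planeNorm q.2.2) * D q.2)))
      (by fun_prop) (by fun_prop) (fun q => by
        rw [← ENNReal.rpow_two, ← ENNReal.rpow_mul]
        norm_num
        nth_rewrite 1 [← hwin]
        exact le_of_eq (by ring))
    refine h1.trans ?_
    have h2 : ∫⁻ q : Freq × Freq, A (-q.1 - q.2) * (window r (planeNorm q.1.2) * κ q.1 q.2) ≤
        2 * (2 * (2 * decayMass b * decayMass b)) * ∫⁻ x, A x := by
      set Φ : Freq → Freq → Freq → ENNReal := fun x y z =>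
        A x * (window r (planeNorm y.2) * κ y z) with hΦ
      have hΦm : Measurable fun q : Freq × Freq × Freq => Φ q.1 q.2.1 q.2.2 := by fun_prop
      have e1 := zeroSumLIntegral_swap_right hΦm
      have e2 := zeroSumLIntegral_swap_left (Φ := fun x y z => Φ x z y) (by fun_prop)
      calc _ = zeroSumLIntegral Φ := by
            rw [Measure.volume_eq_prod (Freq) (Freq), lintegral_prod _ (by fun_prop)]
            rfl
        _ = zeroSumLIntegral (fun x y z => Φ y z x) := by rw [← e1, ← e2]
        _ = ∫⁻ x, A x * ∫⁻ y : Freq, window r (planeNorm y.2) * κ y (-x - y) := by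
            unfold zeroSumLIntegral
            refine lintegral_congr fun x => ?_
            exact lintegral_const_mul _ (by fun_prop)
        _ ≤ ∫⁻ x, A x * (2 * (2 * (2 * decayMass b * decayMass b))) := by
            refine lintegral_mono fun x => ?_
            gcongr
            exact lintegral_diagKernel_window_le b r x
        _ = _ := by rw [lintegral_mul_const _ hA, mul_comm]
    have h3 : ∫⁻ q : Freq × Freq, window r (planeNorm q.1.2) * B q.1 *
        (c * (decay p (r - planeNorm q.2.2) * D q.2)) =
        (∫⁻ y : Freq, window r (planeNorm y.2) * B y) *
          (c * ∫⁻ z : Freq, decay p (r - planeNorm z.2) * D z) := by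
      rw [Measure.volume_eq_prod (Freq) (Freq), lintegral_prod_mul
          (f := fun y : Freq => window r (planeNorm y.2) * B y)
          (g := fun z : Freq => c * (decay p (r - planeNorm z.2) * D z)) (by fun_prop)
          (by fun_prop),
        lintegral_const_mul _ (by fun_prop)]
    rw [h3]
    calc _ ≤ 2 * (2 * (2 * decayMass b * decayMass b)) * (∫⁻ x, A x) *
          ((∫⁻ y : Freq, window r (planeNorm y.2) * B y) *
          (c * ∫⁻ z : Freq, decay p (r - planeNorm z.2) * D z)) := by gcongr
      _ = _ := by ring
  refine (sq_lintegral_le_of_sq_le (hwB.lintegral_prod_right'.const_mul _).aemeasurable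
    hwD.lintegral_prod_right'.aemeasurable hfr).trans ?_
  have hB' : ∫⁻ r, ∫⁻ y : Freq, window r (planeNorm y.2) * B y = 2 * ∫⁻ y, B y := by
    rw [lintegral_lintegral_swap hwB.aemeasurable, ← lintegral_const_mul _ hB]
    refine lintegral_congr fun y => ?_
    rw [lintegral_mul_const _ (by fun_prop), lintegral_window_left]
  have hD' : ∫⁻ r, ∫⁻ z : Freq, decay p (r - planeNorm z.2) * D z = decayMass p * ∫⁻ z, D z := by
    rw [lintegral_lintegral_swap hwD.aemeasurable, ← lintegral_const_mul _ hD]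
    refine lintegral_congr fun z => ?_
    rw [lintegral_mul_const _ (by fun_prop), lintegral_decay_sub]
  rw [lintegral_const_mul _ hwB.lintegral_prod_right', hB', hD']
  exact le_of_eq (by ring)

/-! ### Pointwise bounds for the kernel -/

lemma rpow_mul_rpow_mul_rpow_le {x y z e f g c : ℝ} (hx : 0 < x) (hy : 0 < y) (hz : 0 < z)
    (h : f * log y + e * log x + g * log z ≤ c * log 3) :
    y ^ f * x ^ e * z ^ g ≤ 3 ^ c := by
  rw [Real.rpow_def_of_pos hx, Real.rpow_def_of_pos hy, Real.rpow_def_of_pos hz,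
    Real.rpow_def_of_pos (by norm_num : (0:ℝ) < 3), ← Real.exp_add, ← Real.exp_add,
    Real.exp_le_exp]
  linarith

section Scalar

variable {s s' θ δ x y z : ℝ}

lemma scalar_high_le (hθ : θ ≤ 3/4) (hs : 1/2 ≤ s) (hδ : 2 * s' + 1/2 + δ ≤ 4 * s)
    (hz : 1 ≤ z) (hx : 1 ≤ x) (hxy : x ≤ y) :
    y ^ (2 - 4 * s) * x ^ (2 * s' - 3/2 + δ) * z ^ (2 * θ - 3/2) ≤ 1 := by
  have hy : 1 ≤ y := hx.trans hxy
  refine (rpow_mul_rpow_mul_rpow_le (c := 0) (by linarith) (by linarith) (by linarith) ?_).trans_eq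
    (Real.rpow_zero 3)
  have lz := Real.log_nonneg hz
  have lx := Real.log_nonneg hx
  have lxy := Real.log_le_log (by linarith) hxy
  have h1 : (2 * θ - 3/2) * log z ≤ 0 := mul_nonpos_of_nonpos_of_nonneg (by linarith) lz
  rcases le_total 0 (2 * s' - 3/2 + δ) with h | h
  · nlinarith [mul_le_mul_of_nonneg_left lxy h,
      mul_nonneg (show 0 ≤ 4 * s - (2 * s' + 1/2 + δ) by linarith) (lx.trans lxy)]
  · nlinarith [mul_nonneg (neg_nonneg.2 h) lx,
      mul_nonneg (show 0 ≤ 4 * s - 2 by linarith) (lx.trans lxy)]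

lemma scalar_low_le (hθ : 1/2 ≤ θ) (hs : 1/2 ≤ s) (hδ0 : 0 ≤ δ)
    (hδ : 2 * s' + 1/2 + δ ≤ 4 * s) (hδ' : s' + θ + 1 + δ ≤ 4 * s)
    (hz : 1 ≤ z) (hzx : z ≤ x) (hxy : x ≤ y) (h : x * z ≤ 3 * y) :
    y ^ (2 - 4 * s) * x ^ (2 * s' - 3/2 + δ) * z ^ (2 * θ - 1/2 + δ) ≤ 3 ^ (2 * θ - 1/2 + δ) := by
  have hx : 1 ≤ x := hz.trans hzx
  have hy : 1 ≤ y := hx.trans hxy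
  refine rpow_mul_rpow_mul_rpow_le (by linarith) (by linarith) (by linarith) ?_
  have l3 : 0 < log 3 := Real.log_pos (by norm_num)
  have lz := Real.log_nonneg hz
  have lx := Real.log_nonneg hx
  have lxy := Real.log_le_log (by linarith) hxy
  have lzx := Real.log_le_log (by linarith) hzx
  have lsum : log x + log z ≤ log 3 + log y := by
    rw [← Real.log_mul (by linarith) (by linarith), ← Real.log_mul (by linarith) (by linarith)]
    exact Real.log_le_log (by nlinarith) h
  have ly := lx.trans lxy
  set e := 2 * s' - 3/2 + δ with he
  set f := 2 * θ - 1/2 + δ with hf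
  have hf0 : 0 ≤ f := by rw [hf]; linarith
  rcases le_total f e with hef | hef
  · nlinarith [mul_le_mul_of_nonneg_left lsum hf0, mul_le_mul_of_nonneg_left lxy (sub_nonneg.2 hef),
      mul_nonneg (show 0 ≤ 4 * s - 2 - e by linarith) ly]
  · have h1 := mul_le_mul_of_nonneg_left lzx (sub_nonneg.2 hef)
    rcases le_total 0 (e + f) with h0 | h0
    · nlinarith [mul_le_mul_of_nonneg_left lsum h0, mul_nonneg (sub_nonneg.2 hef) l3.le,
        mul_nonneg (show 0 ≤ 2 * (4 * s - 2) - (e + f) by linarith) ly]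
    · nlinarith [mul_nonneg (neg_nonneg.2 h0) (add_nonneg lx lz), mul_nonneg hf0 l3.le,
        mul_nonneg (show 0 ≤ 4 * s - 2 by linarith) ly]

lemma scalar_diag_le (hθ : θ ≤ 3/4) (hδ0 : 0 ≤ δ)
    (hδ : 2 * s' + 1/2 + δ ≤ 4 * s) (hδ' : s' + θ + 1 + δ ≤ 4 * s)
    (hz : 1 ≤ z) (hzx : z ≤ x) (hxy : x ≤ y) (h : y ≤ x * z) :
    y ^ (3 - 4 * s) * x ^ (2 * s' - 5/2 + δ) * z ^ (2 * θ - 3/2) ≤ 1 := by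
  have hx : 1 ≤ x := hz.trans hzx
  have hy : 1 ≤ y := hx.trans hxy
  refine (rpow_mul_rpow_mul_rpow_le (c := 0) (by linarith) (by linarith) (by linarith) ?_).trans_eq
    (Real.rpow_zero 3)
  have lz := Real.log_nonneg hz
  have lx := Real.log_nonneg hx
  have lxy := Real.log_le_log (by linarith) hxy
  have lzx := Real.log_le_log (by linarith) hzx
  have lsum : log y ≤ log x + log z := by
    rw [← Real.log_mul (by linarith) (by linarith)]
    exact Real.log_le_log (by linarith) h
  have ly := lx.trans lxy
  have h1 := mul_le_mul_of_nonneg_left lsum (show 0 ≤ 3/2 - 2 * θ by linarith)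
  rcases le_total 0 (2 * s' - 1 - 2 * θ + δ) with h0 | h0
  · nlinarith [mul_le_mul_of_nonneg_left lxy h0,
      mul_nonneg (show 0 ≤ 4 * s - (2 * s' + 1/2 + δ) by linarith) ly]
  · nlinarith [mul_le_mul_of_nonneg_left (show log y ≤ 2 * log x by linarith) (neg_nonneg.2 h0),
      mul_nonneg (show 0 ≤ 4 * s - (s' + θ + 1 + δ) by linarith) ly, mul_nonneg hδ0 ly]

end Scalar

section Core

variable {s s' θ δ r m n X g₀ g₂ : ℝ}

lemma weight_base_le (hs0 : 0 ≤ s) (hs : s ≤ 1) (hr : 0 < r) (hrm : r ≤ m) (hrn : r ≤ n)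
    (hmn : |m - n| ≤ r) (hX : 0 ≤ X) (hX2 : X ^ 2 ≤ (m + n) ^ 2 * (r * (r - |m - n|))) :
    X ^ 2 * (r ^ (-2 : ℝ) * (1 + r) ^ (2 * s' - 2) * (1 + m) ^ (-(2 * s)) * (1 + n) ^ (-(2 * s))) ≤
      12 * (X / (m * r) * (r ^ (-1/2 : ℝ) * (1 + r) ^ (-1/2 - δ)) *
        ((1 + m) ^ (2 - 4 * s) * (1 + r) ^ (2 * s' - 3/2 + δ) *
          (1 + (r - |m - n|)) ^ (1/2 : ℝ))) := by
  have hm : 0 < m := hr.trans_le hrm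
  have hn : 0 < n := hr.trans_le hrn
  obtain ⟨hmn1, hmn2⟩ := abs_le.1 hmn
  set D := r - |m - n|
  have hD : 0 ≤ D := sub_nonneg.2 hmn
  have hXle : X ≤ 3 * m * (r ^ (1/2 : ℝ) * (1 + D) ^ (1/2 : ℝ)) := by
    rw [← Real.mul_rpow hr.le (by positivity), ← Real.sqrt_eq_rpow]
    calc X ≤ √((m + n) ^ 2 * (r * D)) := Real.le_sqrt_of_sq_le hX2
      _ = (m + n) * √(r * D) := by
          rw [Real.sqrt_mul (by positivity), Real.sqrt_sq (by positivity)]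
      _ ≤ 3 * m * √(r * (1 + D)) := by
          gcongr
          · linarith
          · linarith
  have hn2 : (1 + n) ^ (-(2 * s)) ≤ 4 * (1 + m) ^ (-(2 * s)) := by
    have h1 : (1 + m) ≤ 2 * (1 + n) := by linarith
    have h2 := Real.rpow_le_rpow_of_nonpos (by positivity) h1 (show -(2 * s) ≤ 0 by linarith)
    rw [Real.mul_rpow (by norm_num) (by positivity), Real.rpow_neg (by norm_num)] at h2
    have h3 : (2 : ℝ) ^ (2 * s) ≤ 4 := by
      calc (2 : ℝ) ^ (2 * s) ≤ 2 ^ (2 : ℝ) :=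
            Real.rpow_le_rpow_of_exponent_le (by norm_num) (by linarith)
        _ = 4 := by norm_num
    have h4 : (0 : ℝ) < 2 ^ (2 * s) := by positivity
    calc (1 + n) ^ (-(2 * s)) = 2 ^ (2 * s) * ((2 ^ (2 * s))⁻¹ * (1 + n) ^ (-(2 * s))) := by
          rw [mul_inv_cancel_left₀ h4.ne']
      _ ≤ 4 * (1 + m) ^ (-(2 * s)) := by gcongr
  have e1 : (1 + m) ^ (2 - 4 * s) =
      (1 + m) ^ 2 * ((1 + m) ^ (-(2 * s)) * (1 + m) ^ (-(2 * s))) := by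
    rw [← Real.rpow_natCast, ← Real.rpow_add (by positivity), ← Real.rpow_add (by positivity)]
    congr 1; push_cast; ring
  have e2 : (1 + r) ^ (-1/2 - δ) * (1 + r) ^ (2 * s' - 3/2 + δ) = (1 + r) ^ (2 * s' - 2) := by
    rw [← Real.rpow_add (by positivity)]; congr 1; ring
  have e3 : r ^ (-2 : ℝ) * r ^ (1/2 : ℝ) = r⁻¹ * r ^ (-1/2 : ℝ) := by
    rw [← Real.rpow_neg_one r, ← Real.rpow_add hr, ← Real.rpow_add hr]; norm_num
  calc _ = X * X * (r ^ (-2 : ℝ) * (1 + r) ^ (2 * s' - 2) * (1 + m) ^ (-(2 * s)) *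
        (1 + n) ^ (-(2 * s))) := by ring
    _ ≤ X * (3 * m * (r ^ (1/2 : ℝ) * (1 + D) ^ (1/2 : ℝ))) * (r ^ (-2 : ℝ) *
        (1 + r) ^ (2 * s' - 2) * (1 + m) ^ (-(2 * s)) * (4 * (1 + m) ^ (-(2 * s)))) := by gcongr
    _ = 12 * (X / m * (r ^ (-2 : ℝ) * r ^ (1/2 : ℝ)) * (1 + r) ^ (2 * s' - 2) *
        (m ^ 2 * ((1 + m) ^ (-(2 * s)) * (1 + m) ^ (-(2 * s))) * (1 + D) ^ (1/2 : ℝ))) := by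
        field_simp; ring
    _ ≤ 12 * (X / m * (r ^ (-2 : ℝ) * r ^ (1/2 : ℝ)) * (1 + r) ^ (2 * s' - 2) *
        ((1 + m) ^ 2 * ((1 + m) ^ (-(2 * s)) * (1 + m) ^ (-(2 * s))) * (1 + D) ^ (1/2 : ℝ))) := by
        gcongr; linarith
    _ = _ := by
        rw [e3, ← e1, ← e2]; field_simp

lemma modulation_weight_le {D g : ℝ} (hθ : θ ≤ 1) (hθ' : 0 ≤ θ) (hD : 0 ≤ D) (h : D ≤ 3 * g) :
    (1 + g) ^ (2 * θ - 2) ≤ 9 * (1 + D) ^ (2 * θ - 2) := by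
  have h1 : (1 + D) ≤ 3 * (1 + g) := by linarith
  have hg : 0 ≤ g := by linarith
  have h2 := Real.rpow_le_rpow_of_nonpos (by positivity) h1 (show 2 * θ - 2 ≤ 0 by linarith)
  have h3 : (9 : ℝ)⁻¹ ≤ 3 ^ (2 * θ - 2) := by
    calc (9 : ℝ)⁻¹ = 3 ^ (-2 : ℝ) := by norm_num [Real.rpow_neg]
      _ ≤ _ := Real.rpow_le_rpow_of_exponent_le (by norm_num) (by linarith)
  rw [Real.mul_rpow (by norm_num) (by positivity)] at h2
  have h4 : 0 ≤ (1 + g) ^ (2 * θ - 2) := by positivity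
  nlinarith [mul_le_mul_of_nonneg_right h3 h4]

lemma weight_high_le (hθ : θ ≤ 3/4) (hθ' : 0 ≤ θ) (hs0 : 1/2 ≤ s) (hs : s ≤ 1)
    (hδ : 2 * s' + 1/2 + δ ≤ 4 * s) (hr : 0 < r) (hrm : r ≤ m) (hrn : r ≤ n)
    (hmn : |m - n| ≤ r) (hX : 0 ≤ X) (hX2 : X ^ 2 ≤ (m + n) ^ 2 * (r * (r - |m - n|)))
    (hg : r - |m - n| ≤ 3 * g₂) :
    X ^ 2 * (r ^ (-2 : ℝ) * (1 + r) ^ (2 * s' - 2) * (1 + m) ^ (-(2 * s)) * (1 + n) ^ (-(2 * s))) *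
      (1 + g₂) ^ (2 * θ - 2) ≤
      108 * (X / (m * r) * (r ^ (-1/2 : ℝ) * (1 + r) ^ (-1/2 - δ))) := by
  have hm : 0 < m := hr.trans_le hrm
  have hn : 0 < n := hr.trans_le hrn
  have hb := weight_base_le (s' := s') (δ := δ) (by linarith) hs hr hrm hrn hmn hX hX2
  set D := r - |m - n|
  have hD : 0 ≤ D := sub_nonneg.2 hmn
  have hg0 : 0 ≤ g₂ := by linarith
  have hg' := modulation_weight_le (by linarith) hθ' hD hg
  have hsc := scalar_high_le (z := 1 + D) (x := 1 + r) (y := 1 + m) hθ hs0 hδ (by linarith)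
    (by linarith) (by linarith)
  have e : (1 + D) ^ (2 * θ - 3/2) = (1 + D) ^ (1/2 : ℝ) * (1 + D) ^ (2 * θ - 2) := by
    rw [← Real.rpow_add (by positivity)]; congr 1; ring
  rw [e] at hsc
  calc _ ≤ 12 * (X / (m * r) * (r ^ (-1/2 : ℝ) * (1 + r) ^ (-1/2 - δ)) *
        ((1 + m) ^ (2 - 4 * s) * (1 + r) ^ (2 * s' - 3/2 + δ) * (1 + D) ^ (1/2 : ℝ))) *
        (9 * (1 + D) ^ (2 * θ - 2)) := by gcongr
    _ = 108 * (X / (m * r) * (r ^ (-1/2 : ℝ) * (1 + r) ^ (-1/2 - δ))) *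
        ((1 + m) ^ (2 - 4 * s) * (1 + r) ^ (2 * s' - 3/2 + δ) *
        ((1 + D) ^ (1/2 : ℝ) * (1 + D) ^ (2 * θ - 2))) := by ring
    _ ≤ _ := mul_le_of_le_one_right (by positivity) hsc

lemma weight_low_le (hθ : θ ≤ 3/4) (hθ' : 1/2 ≤ θ) (hs0 : 1/2 ≤ s) (hs : s ≤ 1) (hδ0 : 0 ≤ δ)
    (hδ : 2 * s' + 1/2 + δ ≤ 4 * s) (hδ' : s' + θ + 1 + δ ≤ 4 * s)
    (hr : 0 < r) (hrm : r ≤ m) (hrn : r ≤ n)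
    (hmn : |m - n| ≤ r) (hX : 0 ≤ X) (hX2 : X ^ 2 ≤ (m + n) ^ 2 * (r * (r - |m - n|)))
    (hg : r - |m - n| ≤ 3 * g₀) (hrD : r * (r - |m - n|) ≤ m) :
    X ^ 2 * (r ^ (-2 : ℝ) * (1 + r) ^ (2 * s' - 2) * (1 + m) ^ (-(2 * s)) * (1 + n) ^ (-(2 * s))) *
      (1 + g₀) ^ (2 * θ - 2) ≤
      108 * 3 ^ (2 * θ - 1/2 + δ) * (X / (m * r) * (r ^ (-1/2 : ℝ) * (1 + r) ^ (-1/2 - δ)) *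
        (1 + |r - (|m - n|)|) ^ (-(1 + δ))) := by
  have hm : 0 < m := hr.trans_le hrm
  have hn : 0 < n := hr.trans_le hrn
  have hb := weight_base_le (s' := s') (δ := δ) (by linarith) hs hr hrm hrn hmn hX hX2
  have hDr : r - |m - n| ≤ r := sub_le_self _ (abs_nonneg _)
  set D := r - |m - n|
  have hD : 0 ≤ D := sub_nonneg.2 hmn
  have hg0 : 0 ≤ g₀ := by linarith
  have hg' := modulation_weight_le (θ := θ) (by linarith) (by linarith) hD hg
  have hsc := scalar_low_le (z := 1 + D) (x := 1 + r) (y := 1 + m) hθ' hs0 hδ0 hδ hδ' (by linarith)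
    (by linarith) (by linarith) (by nlinarith)
  have e : (1 + D) ^ (1/2 : ℝ) * (1 + D) ^ (2 * θ - 2) =
      (1 + D) ^ (2 * θ - 1/2 + δ) * (1 + D) ^ (-(1 + δ)) := by
    rw [← Real.rpow_add (by positivity), ← Real.rpow_add (by positivity)]; congr 1; ring
  rw [abs_of_nonneg hD]
  calc _ ≤ 12 * (X / (m * r) * (r ^ (-1/2 : ℝ) * (1 + r) ^ (-1/2 - δ)) *
        ((1 + m) ^ (2 - 4 * s) * (1 + r) ^ (2 * s' - 3/2 + δ) * (1 + D) ^ (1/2 : ℝ))) *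
        (9 * (1 + D) ^ (2 * θ - 2)) := by gcongr
    _ = 108 * (X / (m * r) * (r ^ (-1/2 : ℝ) * (1 + r) ^ (-1/2 - δ))) *
        ((1 + m) ^ (2 - 4 * s) * (1 + r) ^ (2 * s' - 3/2 + δ) *
        ((1 + D) ^ (1/2 : ℝ) * (1 + D) ^ (2 * θ - 2))) := by ring
    _ = 108 * (X / (m * r) * (r ^ (-1/2 : ℝ) * (1 + r) ^ (-1/2 - δ)) * (1 + D) ^ (-(1 + δ))) *
        ((1 + m) ^ (2 - 4 * s) * (1 + r) ^ (2 * s' - 3/2 + δ) * (1 + D) ^ (2 * θ - 1/2 + δ)) := by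
        rw [e]; ring
    _ ≤ 108 * (X / (m * r) * (r ^ (-1/2 : ℝ) * (1 + r) ^ (-1/2 - δ)) * (1 + D) ^ (-(1 + δ))) *
        3 ^ (2 * θ - 1/2 + δ) := by gcongr
    _ = _ := by ring

lemma weight_diag_le (hθ : θ ≤ 3/4) (hθ' : 0 ≤ θ) (hs0 : 1/2 ≤ s) (hs : s ≤ 1) (hδ0 : 0 ≤ δ)
    (hδ : 2 * s' + 1/2 + δ ≤ 4 * s) (hδ' : s' + θ + 1 + δ ≤ 4 * s)
    (hr : 0 < r) (hrm : r ≤ m) (hrn : r ≤ n)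
    (hmn : |m - n| ≤ r) (hX : 0 ≤ X) (hX2 : X ^ 2 ≤ (m + n) ^ 2 * (r * (r - |m - n|)))
    (hg : r - |m - n| ≤ 3 * g₀) (hrD : m ≤ r * (r - |m - n|)) :
    X ^ 2 * (r ^ (-2 : ℝ) * (1 + r) ^ (2 * s' - 2) * (1 + m) ^ (-(2 * s)) * (1 + n) ^ (-(2 * s))) *
      (1 + g₀) ^ (2 * θ - 2) ≤
      864 * (X / (m * n) * (1 + |m - n|) ^ (-(1 + δ))) := by
  have hm : 0 < m := hr.trans_le hrm
  have hn : 0 < n := hr.trans_le hrn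
  have hb := weight_base_le (s' := s') (δ := δ) (by linarith) hs hr hrm hrn hmn hX hX2
  have hDr : r - |m - n| ≤ r := sub_le_self _ (abs_nonneg _)
  obtain ⟨hmn1, hmn2⟩ := abs_le.1 hmn
  have hlast : (1 + r) ^ (-(1 + δ)) ≤ (1 + |m - n|) ^ (-(1 + δ)) :=
    Real.rpow_le_rpow_of_nonpos (by positivity) (by linarith) (by linarith)
  set D := r - |m - n|
  have hD : 0 ≤ D := sub_nonneg.2 hmn
  have hg0 : 0 ≤ g₀ := by linarith
  have hg' := modulation_weight_le (by linarith) hθ' hD hg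
  have hsc := scalar_diag_le (z := 1 + D) (x := 1 + r) (y := 1 + m) hθ hδ0 hδ hδ' (by linarith)
    (by linarith) (by linarith) (by nlinarith)
  have hD1 : 1 ≤ D := by
    by_contra! hlt
    nlinarith
  have hr1 : 1 ≤ r := hD1.trans hDr
  have hr32 : r⁻¹ * r ^ (-1/2 : ℝ) ≤ 4 * (1 + r) ^ (-3/2 : ℝ) := by
    have h1 : (1 + r) ≤ 2 * r := by linarith
    have h2 := Real.rpow_le_rpow_of_nonpos (by positivity) h1 (show (-3/2 : ℝ) ≤ 0 by norm_num)
    rw [Real.mul_rpow (by norm_num) hr.le] at h2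
    have h3 : (4 : ℝ)⁻¹ ≤ 2 ^ (-3/2 : ℝ) := by
      calc (4 : ℝ)⁻¹ = 2 ^ (-2 : ℝ) := by norm_num [Real.rpow_neg]
        _ ≤ _ := Real.rpow_le_rpow_of_exponent_le (by norm_num) (by norm_num)
    have h4 : r⁻¹ * r ^ (-1/2 : ℝ) = r ^ (-3/2 : ℝ) := by
      rw [← Real.rpow_neg_one r, ← Real.rpow_add hr]; norm_num
    rw [h4]
    have h5 : 0 ≤ r ^ (-3/2 : ℝ) := by positivity
    nlinarith [mul_le_mul_of_nonneg_right h3 h5]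
  have e1 : (1 + D) ^ (1/2 : ℝ) * (1 + D) ^ (2 * θ - 2) = (1 + D) ^ (2 * θ - 3/2) := by
    rw [← Real.rpow_add (by positivity)]; congr 1; ring
  have e2 : (1 + m) * (1 + m) ^ (2 - 4 * s) = (1 + m) ^ (3 - 4 * s) := by
    nth_rewrite 1 [← Real.rpow_one (1 + m)]
    rw [← Real.rpow_add (by positivity)]; congr 1; ring
  have e3 : (1 + r) ^ (-3/2 : ℝ) * ((1 + r) ^ (-1/2 - δ) * (1 + r) ^ (2 * s' - 3/2 + δ)) =
      (1 + r) ^ (-(1 + δ)) * (1 + r) ^ (2 * s' - 5/2 + δ) := by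
    rw [← Real.rpow_add (by positivity), ← Real.rpow_add (by positivity),
      ← Real.rpow_add (by positivity)]
    congr 1; ring
  calc _ ≤ 12 * (X / (m * r) * (r ^ (-1/2 : ℝ) * (1 + r) ^ (-1/2 - δ)) *
        ((1 + m) ^ (2 - 4 * s) * (1 + r) ^ (2 * s' - 3/2 + δ) * (1 + D) ^ (1/2 : ℝ))) *
        (9 * (1 + D) ^ (2 * θ - 2)) := by gcongr
    _ = 108 * (X / (m * n)) * n * (r⁻¹ * r ^ (-1/2 : ℝ)) * ((1 + r) ^ (-1/2 - δ) *
        (1 + r) ^ (2 * s' - 3/2 + δ)) * (1 + m) ^ (2 - 4 * s) *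
        ((1 + D) ^ (1/2 : ℝ) * (1 + D) ^ (2 * θ - 2)) := by field_simp; ring
    _ ≤ 108 * (X / (m * n)) * (2 * (1 + m)) * (4 * (1 + r) ^ (-3/2 : ℝ)) * ((1 + r) ^ (-1/2 - δ) *
        (1 + r) ^ (2 * s' - 3/2 + δ)) * (1 + m) ^ (2 - 4 * s) *
        ((1 + D) ^ (1/2 : ℝ) * (1 + D) ^ (2 * θ - 2)) := by gcongr; linarith
    _ = 864 * (X / (m * n)) * ((1 + r) ^ (-3/2 : ℝ) * ((1 + r) ^ (-1/2 - δ) *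
        (1 + r) ^ (2 * s' - 3/2 + δ))) * ((1 + m) * (1 + m) ^ (2 - 4 * s)) *
        ((1 + D) ^ (1/2 : ℝ) * (1 + D) ^ (2 * θ - 2)) := by ring
    _ = 864 * (X / (m * n) * (1 + r) ^ (-(1 + δ))) * ((1 + m) ^ (3 - 4 * s) *
        (1 + r) ^ (2 * s' - 5/2 + δ) * (1 + D) ^ (2 * θ - 3/2)) := by rw [e1, e2, e3]; ring
    _ ≤ 864 * (X / (m * n) * (1 + r) ^ (-(1 + δ))) := mul_le_of_le_one_right (by positivity) hsc
    _ ≤ _ := by gcongr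

end Core

/-! ### Domination of the null-form kernel by the model kernels -/

lemma planeCross_swap (x y : ℝ × ℝ) : planeCross y x = -planeCross x y := by
  unfold planeCross; ring

lemma abs_planeNorm_sub_le (x y : ℝ × ℝ) : |planeNorm x - planeNorm y| ≤ planeNorm (x + y) := by
  refine abs_le_of_sq_le_sq ?_ (planeNorm_nonneg _)
  have hx := planeNorm_sq x
  have hy := planeNorm_sq y
  have hxy := planeNorm_sq (x + y)
  simp only [Prod.fst_add, Prod.snd_add] at hxy
  have h : -(x.1 * y.1 + x.2 * y.2) ≤ planeNorm x * planeNorm y := by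
    refine le_of_abs_le (abs_le_of_sq_le_sq ?_
      (mul_nonneg (planeNorm_nonneg _) (planeNorm_nonneg _)))
    rw [mul_pow, hx, hy]
    nlinarith [sq_nonneg (x.1 * y.2 - x.2 * y.1)]
  nlinarith

lemma planeCross_sq_le (x y : ℝ × ℝ) :
    planeCross x y ^ 2 ≤ (planeNorm x + planeNorm y) ^ 2 *
      (planeNorm (x + y) * (planeNorm (x + y) - |planeNorm x - planeNorm y|)) := by
  have h := abs_planeNorm_sub_le x y
  have hr := planeNorm_nonneg (x + y)
  have hD := sub_nonneg.2 h
  have h1 : planeNorm (x + y) ^ 2 - (planeNorm x - planeNorm y) ^ 2 ≤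
      2 * (planeNorm (x + y) * (planeNorm (x + y) - |planeNorm x - planeNorm y|)) := by
    rw [← sq_abs (planeNorm x - planeNorm y)]
    nlinarith
  have h2 : 0 ≤ planeNorm (x + y) ^ 2 - (planeNorm x - planeNorm y) ^ 2 := by
    rw [← sq_abs (planeNorm x - planeNorm y)]
    nlinarith [abs_nonneg (planeNorm x - planeNorm y)]
  have h3 : (planeNorm x + planeNorm y) ^ 2 - planeNorm (x + y) ^ 2 ≤
      (planeNorm x + planeNorm y) ^ 2 := by nlinarith [sq_nonneg (planeNorm (x + y))]
  rw [planeCross_sq]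
  have h4 := mul_le_mul_of_nonneg_right h3 h2
  have h5 := mul_le_mul_of_nonneg_left h1 (sq_nonneg (planeNorm x + planeNorm y))
  have h6 := mul_nonneg (sq_nonneg (planeNorm x + planeNorm y)) (mul_nonneg hr hD)
  linarith

lemma planeNorm_sub_le_modulation {x y z : Freq} (h : x + y + z = 0)
    (hxy : planeNorm x.2 ≤ planeNorm y.2) (hxz : planeNorm x.2 ≤ planeNorm z.2) :
    planeNorm x.2 - |planeNorm y.2 - planeNorm z.2| ≤
      |modulation x| + |modulation y| + |modulation z| := by
  have h1 : x.1 + y.1 + z.1 = 0 := congrArg Prod.fst h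
  unfold modulation
  set r := planeNorm x.2
  set m := planeNorm y.2
  set n := planeNorm z.2
  have a1 := neg_abs_le (|x.1| - r)
  have a2 := neg_abs_le (|y.1| - m)
  have a3 := neg_abs_le (|z.1| - n)
  have b1 := le_abs_self (|x.1| - r)
  have b2 := le_abs_self (|y.1| - m)
  have b3 := le_abs_self (|z.1| - n)
  have c1 := neg_abs_le (m - n)
  have c2 := le_abs_self (m - n)
  have c3 : m - n ≤ |m - n| := c2
  rcases abs_cases (m - n) with hmn | hmn <;> rcases abs_cases x.1 with hx | hx <;>
    rcases abs_cases y.1 with hy | hy <;> rcases abs_cases z.1 with hz | hz <;> linarith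

/-- The elliptic weight of the estimate. -/
def ellipticWeight (s s' r m n : ℝ) : ℝ :=
  r ^ (-2 : ℝ) * (1 + r) ^ (2 * s' - 2) * (1 + m) ^ (-(2 * s)) * (1 + n) ^ (-(2 * s))

/-- The hyperbolic weight of the estimate. -/
def hyperbolicWeight (θ b g h k : ℝ) : ℝ :=
  (1 + g) ^ (2 * θ - 2) * (1 + h) ^ (-b) * (1 + k) ^ (-b)

lemma ellipticWeight_comm (s s' r m n : ℝ) :
    ellipticWeight s s' r m n = ellipticWeight s s' r n m := by
  unfold ellipticWeight; ring

lemma hyperbolicWeight_comm (θ b g h k : ℝ) :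
    hyperbolicWeight θ b g h k = hyperbolicWeight θ b g k h := by
  unfold hyperbolicWeight; ring

lemma ellipticWeight_nonneg {s s' r m n : ℝ} (hr : 0 ≤ r) (hm : 0 ≤ m) (hn : 0 ≤ n) :
    0 ≤ ellipticWeight s s' r m n := by
  unfold ellipticWeight; positivity

lemma hyperbolicWeight_nonneg {θ b g h k : ℝ} (hg : 0 ≤ g) (hh : 0 ≤ h) (hk : 0 ≤ k) :
    0 ≤ hyperbolicWeight θ b g h k := by
  unfold hyperbolicWeight; positivity

lemma ellipticWeight_le_of_le {s s' r m n : ℝ} (hs : s ≤ 1) (hs' : s' ≤ 1) (hm : 0 < m)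
    (hmr : m ≤ r) (hn : 0 ≤ n) : ellipticWeight s s' r m n ≤ ellipticWeight s s' m r n := by
  have hr : 0 < r := hm.trans_le hmr
  have key : ∀ t : ℝ, 0 < t → t ^ (-2 : ℝ) * (1 + t) ^ (2 * s' - 2) =
      (1 + t⁻¹) ^ (2 : ℝ) * (1 + t) ^ (2 * s' + 2 * s - 4) * (1 + t) ^ (-(2 * s)) := fun t ht => by
    have h1 : 1 + t⁻¹ = (1 + t) * t⁻¹ := by field_simp; ring
    have h2 : (t⁻¹) ^ (2 : ℝ) = t ^ (-2 : ℝ) := by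
      rw [Real.inv_rpow ht.le, Real.rpow_neg ht.le]
    rw [h1, Real.mul_rpow (by positivity) (by positivity), h2]
    have h3 : (1 + t) ^ (2 * s' - 2) =
        (1 + t) ^ (2 : ℝ) * (1 + t) ^ (2 * s' + 2 * s - 4) * (1 + t) ^ (-(2 * s)) := by
      rw [← Real.rpow_add (by positivity), ← Real.rpow_add (by positivity)]; congr 1; ring
    rw [h3]; ring
  have h1 : (1 + r⁻¹) ^ (2 : ℝ) ≤ (1 + m⁻¹) ^ (2 : ℝ) := by gcongr
  have h2 : (1 + r) ^ (2 * s' + 2 * s - 4) ≤ (1 + m) ^ (2 * s' + 2 * s - 4) :=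
    Real.rpow_le_rpow_of_nonpos (by positivity) (by linarith) (by linarith)
  unfold ellipticWeight
  rw [key r hr, key m hm]
  calc _ ≤ (1 + m⁻¹) ^ (2 : ℝ) * (1 + m) ^ (2 * s' + 2 * s - 4) * (1 + r) ^ (-(2 * s)) *
        (1 + m) ^ (-(2 * s)) * (1 + n) ^ (-(2 * s)) := by gcongr
    _ = _ := by ring

lemma hyperbolicWeight_le_of_le {θ b g h k : ℝ} (hb : 2 - 2 * θ ≤ b) (hg : 0 ≤ g) (hgh : g ≤ h)
    (hk : 0 ≤ k) : hyperbolicWeight θ b g h k ≤ hyperbolicWeight θ b h g k := by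
  have hh : 0 ≤ h := hg.trans hgh
  have key : ∀ t : ℝ, 0 ≤ t → (1 + t) ^ (2 * θ - 2) =
      (1 + t) ^ (b - (2 - 2 * θ)) * (1 + t) ^ (-b) := fun t ht => by
    rw [← Real.rpow_add (by positivity)]; congr 1; ring
  have h1 : (1 + g) ^ (b - (2 - 2 * θ)) ≤ (1 + h) ^ (b - (2 - 2 * θ)) :=
    Real.rpow_le_rpow (by positivity) (by linarith) (by linarith)
  unfold hyperbolicWeight
  rw [key g hg, key h hh]
  calc _ ≤ (1 + h) ^ (b - (2 - 2 * θ)) * (1 + g) ^ (-b) * (1 + h) ^ (-b) * (1 + k) ^ (-b) := by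
        gcongr
    _ = _ := by ring

/-- The sum of the model kernels when the first frequency is the smallest one. -/
def modelKernel (p b δ : ℝ) (x y z : Freq) : ENNReal :=
  lowKernel p b δ x y z + diagKernel p b x y z + highKernel b δ x y z + highKernel b δ x z y

lemma isAdmissible_modelKernel {p b δ : ℝ} (hp : 1 < p) (hb : 1 < b) (hδ : 0 < δ) :
    IsAdmissible (modelKernel p b δ) :=
  (((isAdmissible_lowKernel hp hb hδ).add (isAdmissible_diagKernel hp hb)).add
    (isAdmissible_highKernel hb hδ)).add (isAdmissible_highKernel hb hδ).swap_right

section Domination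

variable {s s' θ b δ : ℝ}

lemma ofReal_le_modelKernel (hθ : θ ≤ 3/4) (hθ' : 1/2 ≤ θ) (hs0 : 1/2 ≤ s) (hs : s ≤ 1)
    (hδ0 : 0 ≤ δ) (hδ : 2 * s' + 1/2 + δ ≤ 4 * s) (hδ' : s' + θ + 1 + δ ≤ 4 * s) (hb : 0 ≤ b)
    {x y z : Freq} (h : x + y + z = 0) (hx : 0 < planeNorm x.2)
    (hxy : planeNorm x.2 ≤ planeNorm y.2) (hxz : planeNorm x.2 ≤ planeNorm z.2) {E V : ℝ}
    (hE0 : 0 ≤ E) (hE : E ≤ ellipticWeight s s' (planeNorm x.2) (planeNorm y.2) (planeNorm z.2))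
    (hVx : |modulation y| ≤ |modulation x| → |modulation z| ≤ |modulation x| →
      V ≤ hyperbolicWeight θ b |modulation x| |modulation y| |modulation z|)
    (hVy : |modulation x| ≤ |modulation y| → |modulation z| ≤ |modulation y| →
      V ≤ hyperbolicWeight θ b |modulation y| |modulation x| |modulation z|)
    (hVz : |modulation x| ≤ |modulation z| → |modulation y| ≤ |modulation z| →
      V ≤ hyperbolicWeight θ b |modulation z| |modulation x| |modulation y|) :
    ENNReal.ofReal (planeCross y.2 z.2 ^ 2 * (E * V)) ≤
      ENNReal.ofReal (864 + 108 * 3 ^ (2 * θ - 1/2 + δ)) * modelKernel (1 + δ) b δ x y z := by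
  have hD := planeNorm_sub_le_modulation h hxy hxz
  have hsum : planeNorm (y.2 + z.2) = planeNorm x.2 := by
    have : y.2 + z.2 = -x.2 := by
      have := congrArg Prod.snd h
      simp only [Prod.snd_add, Prod.snd_zero] at this
      rw [eq_neg_iff_add_eq_zero, ← this]; abel
    rw [this, planeNorm_neg]
  have hmn := abs_planeNorm_sub_le y.2 z.2
  have hX2 := planeCross_sq_le y.2 z.2
  rw [hsum] at hmn hX2
  rw [← sq_abs] at hX2 ⊢
  have hX := abs_nonneg (planeCross y.2 z.2)
  have hzy : |planeCross z.2 y.2| = |planeCross y.2 z.2| := by rw [planeCross_swap, abs_neg]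
  have hC : (0:ℝ) ≤ 3 ^ (2 * θ - 1/2 + δ) := by positivity
  unfold modelKernel lowKernel diagKernel highKernel crossWeight halfDecay decay
  rw [hzy]
  set X := |planeCross y.2 z.2|
  set r := planeNorm x.2
  set m := planeNorm y.2
  set n := planeNorm z.2
  have hm : 0 < m := hx.trans_le hxy
  have hn : 0 < n := hx.trans_le hxz
  set gx := |modulation x|
  set gy := |modulation y|
  set gz := |modulation z|
  have hgx : 0 ≤ gx := abs_nonneg _
  have hgy : 0 ≤ gy := abs_nonneg _
  have hgz : 0 ≤ gz := abs_nonneg _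
  have step : ∀ {g h k F c : ℝ}, 0 ≤ g → 0 ≤ h → 0 ≤ k → V ≤ hyperbolicWeight θ b g h k →
      X ^ 2 * ellipticWeight s s' r m n * (1 + g) ^ (2 * θ - 2) ≤ c * F →
      X ^ 2 * (E * V) ≤ c * (F * ((1 + h) ^ (-b) * (1 + k) ^ (-b))) :=
    fun {g h k F c} hg hh hk hV hF => by
      calc X ^ 2 * (E * V) ≤ X ^ 2 * (ellipticWeight s s' r m n * hyperbolicWeight θ b g h k) := by
            have := hyperbolicWeight_nonneg (θ := θ) (b := b) hg hh hk
            exact mul_le_mul_of_nonneg_left ((mul_le_mul_of_nonneg_left hV hE0).trans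
              (mul_le_mul_of_nonneg_right hE this)) (sq_nonneg X)
        _ = X ^ 2 * ellipticWeight s s' r m n * (1 + g) ^ (2 * θ - 2) *
            ((1 + h) ^ (-b) * (1 + k) ^ (-b)) := by unfold hyperbolicWeight; ring
        _ ≤ c * F * ((1 + h) ^ (-b) * (1 + k) ^ (-b)) := by gcongr
        _ = _ := by ring
  have fin : ∀ {c F : ℝ} {κ : ENNReal}, 0 ≤ F → c ≤ 864 + 108 * 3 ^ (2 * θ - 1/2 + δ) →
      X ^ 2 * (E * V) ≤ c * F → ENNReal.ofReal F ≤ κ → ENNReal.ofReal (X ^ 2 * (E * V)) ≤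
        ENNReal.ofReal (864 + 108 * 3 ^ (2 * θ - 1/2 + δ)) * κ := fun {c F κ} hF hc hle hκ => by
    calc _ ≤ ENNReal.ofReal ((864 + 108 * 3 ^ (2 * θ - 1/2 + δ)) * F) := by
          refine ENNReal.ofReal_le_ofReal (hle.trans ?_)
          gcongr
      _ = _ := ENNReal.ofReal_mul (by positivity)
      _ ≤ _ := by gcongr
  have one : ∀ {k : ℝ}, 0 ≤ k → (1 + k) ^ (-b) ≤ 1 := fun hk =>
    Real.rpow_le_one_of_one_le_of_nonpos (by linarith) (by linarith)
  have hE' : ∀ {m' n' : ℝ}, ellipticWeight s s' r m' n' = r ^ (-2 : ℝ) * (1 + r) ^ (2 * s' - 2) *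
      (1 + m') ^ (-(2 * s)) * (1 + n') ^ (-(2 * s)) := rfl
  by_cases hcx : gy ≤ gx ∧ gz ≤ gx
  · have hg : r - |m - n| ≤ 3 * gx := by linarith [hcx.1, hcx.2]
    have hV := hVx hcx.1 hcx.2
    rcases le_total (r * (r - |m - n|)) m with hrD | hrD
    · have hF := weight_low_le (s := s) (s' := s') hθ hθ' hs0 hs hδ0 hδ hδ' hx hxy hxz hmn hX hX2
        hg hrD
      rw [← hE'] at hF
      refine fin (by positivity) (by linarith) (step hgx hgy hgz hV hF) ?_
      refine le_add_right (le_add_right (le_add_right ?_))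
      rw [← ENNReal.ofReal_mul (by positivity), ← ENNReal.ofReal_mul (by positivity),
        ← ENNReal.ofReal_mul (by positivity)]
      refine ENNReal.ofReal_le_ofReal ?_
      calc _ ≤ X / (m * r) * (r ^ (-1/2 : ℝ) * (1 + r) ^ (-1/2 - δ)) *
            (1 + |r - (|m - n|)|) ^ (-(1 + δ)) * ((1 + gy) ^ (-b) * 1) := by
            gcongr
            exact one hgz
        _ = _ := by ring
    · have hF := weight_diag_le (s := s) (s' := s') hθ (by linarith) hs0 hs hδ0 hδ hδ' hx hxy hxz
        hmn hX hX2 hg hrD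
      rw [← hE'] at hF
      refine fin (by positivity) (by linarith) (step hgx hgy hgz hV hF) ?_
      refine le_add_right (le_add_right (le_add_left ?_))
      rw [← ENNReal.ofReal_mul (by positivity), ← ENNReal.ofReal_mul (by positivity),
        ← ENNReal.ofReal_mul (by positivity)]
      refine ENNReal.ofReal_le_ofReal (le_of_eq ?_)
      ring
  · by_cases hcz : gx ≤ gz ∧ gy ≤ gz
    · have hF := weight_high_le (s := s) (s' := s') (g₂ := gz) hθ (by linarith) hs0 hs hδ hx hxy hxz
        hmn hX hX2 (by linarith [hcz.1, hcz.2])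
      rw [← hE'] at hF
      refine fin (by positivity) (by linarith) (step hgz hgx hgy (hVz hcz.1 hcz.2) hF) ?_
      refine le_add_right (le_add_left ?_)
      rw [← ENNReal.ofReal_mul (by positivity), ← ENNReal.ofReal_mul (by positivity),
        ← ENNReal.ofReal_mul (by positivity)]
      refine ENNReal.ofReal_le_ofReal (le_of_eq ?_)
      ring
    · have hgxy : gx ≤ gy ∧ gz ≤ gy := by
        by_contra hcy
        rcases le_total gx gy with h1 | h1 <;> rcases le_total gy gz with h2 | h2 <;>
          rcases le_total gx gz with h3 | h3 <;> grind
      rw [abs_sub_comm] at hmn hX2 hD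
      rw [add_comm m n] at hX2
      have hF := weight_high_le (s := s) (s' := s') (g₂ := gy) hθ (by linarith) hs0 hs hδ hx hxz hxy
        hmn hX hX2 (by linarith [hgxy.1, hgxy.2])
      rw [← hE', ellipticWeight_comm] at hF
      refine fin (by positivity) (by linarith) (step hgy hgx hgz (hVy hgxy.1 hgxy.2) hF) ?_
      refine le_add_left ?_
      rw [← ENNReal.ofReal_mul (by positivity), ← ENNReal.ofReal_mul (by positivity),
        ← ENNReal.ofReal_mul (by positivity)]
      refine ENNReal.ofReal_le_ofReal (le_of_eq ?_)
      ring

/-- The squared kernel of the bilinear estimate. -/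
def nullKernel (s s' θ b : ℝ) (x y z : Freq) : ENNReal :=
  ENNReal.ofReal (planeCross y.2 z.2 ^ 2 *
    (ellipticWeight s s' (planeNorm x.2) (planeNorm y.2) (planeNorm z.2) *
      hyperbolicWeight θ b |modulation x| |modulation y| |modulation z|))

/-- The symmetrized model kernel. -/
def symKernel (p b δ : ℝ) (x y z : Freq) : ENNReal :=
  modelKernel p b δ x y z + modelKernel p b δ y x z + modelKernel p b δ z x y

lemma isAdmissible_symKernel {p b δ : ℝ} (hp : 1 < p) (hb : 1 < b) (hδ : 0 < δ) :
    IsAdmissible (symKernel p b δ) :=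
  have h := isAdmissible_modelKernel hp hb hδ
  (h.add h.swap_left).add h.swap_left.swap_right

lemma nullKernel_le_symKernel (hθ : θ ≤ 3/4) (hθ' : 1/2 ≤ θ) (hs0 : 1/2 ≤ s) (hs : s ≤ 1)
    (hs' : s' ≤ 1) (hδ0 : 0 ≤ δ) (hδ : 2 * s' + 1/2 + δ ≤ 4 * s) (hδ' : s' + θ + 1 + δ ≤ 4 * s)
    (hb : 2 - 2 * θ ≤ b) {x y z : Freq} (h : x + y + z = 0) :
    nullKernel s s' θ b x y z ≤
      ENNReal.ofReal (864 + 108 * 3 ^ (2 * θ - 1/2 + δ)) * symKernel (1 + δ) b δ x y z := by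
  unfold nullKernel symKernel
  by_cases hc : planeCross y.2 z.2 = 0
  · simp [hc]
  have h2 : x.2 + y.2 + z.2 = 0 := congrArg Prod.snd h
  have hyx : planeCross y.2 z.2 = planeCross z.2 x.2 := by
    have h3 : y.2 = -(x.2 + z.2) := by rw [eq_neg_iff_add_eq_zero, ← h2]; abel
    rw [h3]; simp only [planeCross, Prod.fst_neg, Prod.snd_neg, Prod.fst_add, Prod.snd_add]; ring
  have hxy : planeCross y.2 z.2 = planeCross x.2 y.2 := by
    have h3 : z.2 = -(x.2 + y.2) := by rw [eq_neg_iff_add_eq_zero, ← h2]; abel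
    rw [h3]; simp only [planeCross, Prod.fst_neg, Prod.snd_neg, Prod.fst_add, Prod.snd_add]; ring
  have hy0 : 0 < planeNorm y.2 := planeNorm_pos hc
  have hz0 : 0 < planeNorm z.2 := planeNorm_pos (hyx ▸ hc)
  have hx0 : 0 < planeNorm x.2 := planeNorm_pos (hxy ▸ hc)
  have hE0 := ellipticWeight_nonneg (s := s) (s' := s') hx0.le hy0.le hz0.le
  have gx := abs_nonneg (modulation x)
  have gy := abs_nonneg (modulation y)
  have gz := abs_nonneg (modulation z)
  have hb0 : 0 ≤ b := by linarith
  rw [mul_add, mul_add]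
  by_cases hx : planeNorm x.2 ≤ planeNorm y.2 ∧ planeNorm x.2 ≤ planeNorm z.2
  · refine le_add_right (le_add_right ?_)
    refine ofReal_le_modelKernel hθ hθ' hs0 hs hδ0 hδ hδ' hb0 h hx0 hx.1 hx.2 hE0 le_rfl
      (fun _ _ => le_rfl) (fun h1 _ => hyperbolicWeight_le_of_le hb gx h1 gz) (fun h1 _ => ?_)
    rw [hyperbolicWeight_comm]
    exact hyperbolicWeight_le_of_le hb gx h1 gy
  · by_cases hy : planeNorm y.2 ≤ planeNorm x.2 ∧ planeNorm y.2 ≤ planeNorm z.2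
    · refine le_add_right (le_add_left ?_)
      rw [hyx, planeCross_swap, neg_sq]
      refine ofReal_le_modelKernel hθ hθ' hs0 hs hδ0 hδ hδ' hb0 (by rw [← h]; abel) hy0 hy.1 hy.2
        hE0 (ellipticWeight_le_of_le hs hs' hy0 hy.1 hz0.le)
        (fun h1 _ => hyperbolicWeight_le_of_le hb gx h1 gz) (fun _ _ => le_rfl) (fun _ h1 => ?_)
      rw [hyperbolicWeight_comm, hyperbolicWeight_comm _ _ |modulation z|]
      exact hyperbolicWeight_le_of_le hb gx h1 gy
    · have hz : planeNorm z.2 ≤ planeNorm x.2 ∧ planeNorm z.2 ≤ planeNorm y.2 := by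
        rcases le_total (planeNorm x.2) (planeNorm y.2) with h1 | h1 <;>
          rcases le_total (planeNorm y.2) (planeNorm z.2) with h2 | h2 <;>
          rcases le_total (planeNorm x.2) (planeNorm z.2) with h3 | h3 <;> grind
      refine le_add_left ?_
      rw [hxy]
      refine ofReal_le_modelKernel hθ hθ' hs0 hs hδ0 hδ hδ' hb0 (by rw [← h]; abel) hz0 hz.1 hz.2
        hE0 ?_ (fun h1 _ => ?_) (fun _ _ => ?_) (fun _ h1 => ?_)
      · rw [ellipticWeight_comm]
        exact ellipticWeight_le_of_le hs hs' hz0 hz.1 hy0.le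
      · rw [hyperbolicWeight_comm]
        exact hyperbolicWeight_le_of_le hb gx h1 gy
      · exact (hyperbolicWeight_comm ..).le
      · rw [hyperbolicWeight_comm _ _ |modulation y|]
        exact hyperbolicWeight_le_of_le hb gx h1 gz

end Domination

/-! ### The bilinear estimate on the frequency side -/

/-- The weight on the output of the bilinear estimate. -/
def outWeight (s' θ : ℝ) (x : Freq) : ℝ :=
  planeNorm x.2 ^ (-2 : ℝ) * (1 + planeNorm x.2 ^ 2) ^ (s' - 1) *
    (1 + |modulation x|) ^ (2 * (θ - 1))

/-- The weight on the inputs of the bilinear estimate. -/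
def inWeight (s b : ℝ) (x : Freq) : ℝ :=
  (1 + planeNorm x.2 ^ 2) ^ s * (1 + |modulation x|) ^ b

@[fun_prop]
lemma measurable_outWeight (s' θ : ℝ) : Measurable (outWeight s' θ) := by
  unfold outWeight; fun_prop

@[fun_prop]
lemma measurable_inWeight (s b : ℝ) : Measurable (inWeight s b) := by
  unfold inWeight; fun_prop

lemma outWeight_nonneg (s' θ : ℝ) (x : Freq) : 0 ≤ outWeight s' θ x := by
  have := planeNorm_nonneg x.2
  unfold outWeight; positivity

lemma inWeight_pos (s b : ℝ) (x : Freq) : 0 < inWeight s b x := by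
  unfold inWeight; positivity

lemma one_add_rpow_two_mul_le {ρ s : ℝ} (hρ : 0 ≤ ρ) (hs : 0 ≤ s) (hs' : s ≤ 1) :
    (1 + ρ) ^ (2 * s) ≤ 2 * (1 + ρ ^ 2) ^ s := by
  calc (1 + ρ) ^ (2 * s) = ((1 + ρ) ^ 2) ^ s := by
        rw [Real.rpow_mul (by positivity), Real.rpow_two]
    _ ≤ (2 * (1 + ρ ^ 2)) ^ s := by
        gcongr
        nlinarith [sq_nonneg (1 - ρ)]
    _ = 2 ^ s * (1 + ρ ^ 2) ^ s := Real.mul_rpow (by norm_num) (by positivity)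
    _ ≤ 2 * (1 + ρ ^ 2) ^ s := by
        gcongr
        calc (2 : ℝ) ^ s ≤ 2 ^ (1 : ℝ) := Real.rpow_le_rpow_of_exponent_le (by norm_num) hs'
          _ = 2 := Real.rpow_one 2

lemma outWeight_le {s s' θ b : ℝ} (hs : 0 ≤ s) (hs1 : s ≤ 1) (hs' : 0 ≤ s') (hs1' : s' ≤ 1)
    (x y z : Freq) : outWeight s' θ x ≤
      8 * (ellipticWeight s s' (planeNorm x.2) (planeNorm y.2) (planeNorm z.2) *
        hyperbolicWeight θ b |modulation x| |modulation y| |modulation z|) *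
        (inWeight s b y * inWeight s b z) := by
  have hx := planeNorm_nonneg x.2
  have key : ∀ w : Freq, 1 ≤ 2 * ((1 + planeNorm w.2) ^ (-(2 * s)) *
      (1 + |modulation w|) ^ (-b) * inWeight s b w) := fun w => by
    have hw := planeNorm_nonneg w.2
    have h1 := one_add_rpow_two_mul_le hw hs hs1
    have h2 : 0 < (1 + planeNorm w.2) ^ (2 * s) := by positivity
    have h3 : 0 < (1 + |modulation w|) ^ b := by positivity
    unfold inWeight
    rw [Real.rpow_neg (by positivity), Real.rpow_neg (by positivity)]
    field_simp
    linarith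
  have hout : (1 + planeNorm x.2 ^ 2) ^ (s' - 1) ≤ 2 * (1 + planeNorm x.2) ^ (2 * s' - 2) := by
    have h1 := one_add_rpow_two_mul_le hx (show 0 ≤ 1 - s' by linarith) (by linarith)
    have e1 : (1 + planeNorm x.2 ^ 2) ^ (s' - 1) = ((1 + planeNorm x.2 ^ 2) ^ (1 - s'))⁻¹ := by
      rw [← Real.rpow_neg (by positivity)]; congr 1; ring
    have e2 : (1 + planeNorm x.2) ^ (2 * s' - 2) = ((1 + planeNorm x.2) ^ (2 * (1 - s')))⁻¹ := by
      rw [← Real.rpow_neg (by positivity)]; congr 1; ring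
    rw [e1, e2, inv_le_iff_one_le_mul₀ (by positivity)]
    have h2 : 0 < (1 + planeNorm x.2) ^ (2 * (1 - s')) := by positivity
    field_simp
    linarith
  have ky := key y
  have kz := key z
  have hy0 := inWeight_pos s b y
  have hz0 := inWeight_pos s b z
  have hy := planeNorm_nonneg y.2
  have hz := planeNorm_nonneg z.2
  have e : 2 * (θ - 1) = 2 * θ - 2 := by ring
  unfold outWeight
  rw [e]
  calc _ ≤ planeNorm x.2 ^ (-2 : ℝ) * (2 * (1 + planeNorm x.2) ^ (2 * s' - 2)) *
        (1 + |modulation x|) ^ (2 * θ - 2) := by gcongr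
    _ = planeNorm x.2 ^ (-2 : ℝ) * (2 * (1 + planeNorm x.2) ^ (2 * s' - 2)) *
        (1 + |modulation x|) ^ (2 * θ - 2) * (1 * 1) := by ring
    _ ≤ planeNorm x.2 ^ (-2 : ℝ) * (2 * (1 + planeNorm x.2) ^ (2 * s' - 2)) *
        (1 + |modulation x|) ^ (2 * θ - 2) * ((2 * ((1 + planeNorm y.2) ^ (-(2 * s)) *
        (1 + |modulation y|) ^ (-b) * inWeight s b y)) * (2 * ((1 + planeNorm z.2) ^ (-(2 * s)) *
        (1 + |modulation z|) ^ (-b) * inWeight s b z))) := by gcongr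
    _ = _ := by unfold ellipticWeight hyperbolicWeight; ring

lemma outWeight_neg (s' θ : ℝ) (x : Freq) : outWeight s' θ (-x) = outWeight s' θ x := by
  simp [outWeight, modulation, planeNorm_neg]

theorem lintegral_outWeight_le {s s' θ b δ : ℝ} (hθ : θ ≤ 3/4) (hθ' : 1/2 ≤ θ) (hs0 : 1/2 ≤ s)
    (hs : s ≤ 1) (hs0' : 0 ≤ s') (hs' : s' ≤ 1) (hδ0 : 0 < δ) (hδ : 2 * s' + 1/2 + δ ≤ 4 * s)
    (hδ' : s' + θ + 1 + δ ≤ 4 * s) (hb : 2 - 2 * θ ≤ b) (hb1 : 1 < b) {c : ENNReal} (hc : c ≠ ⊤) :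
    ∃ C : ENNReal, C ≠ ⊤ ∧ ∀ Q U V : Freq → ENNReal, Measurable Q → Measurable U → Measurable V →
      (∀ x, Q x ≤ c * ∫⁻ y, ENNReal.ofReal |planeCross y.2 (x - y).2| * (U y * V (x - y))) →
      ∫⁻ x, ENNReal.ofReal (outWeight s' θ x) * Q x ^ 2 ≠ ⊤ →
      ∫⁻ x, ENNReal.ofReal (outWeight s' θ x) * Q x ^ 2 ≤
        C * ((∫⁻ x, ENNReal.ofReal (inWeight s b x) * U x ^ 2) *
          ∫⁻ x, ENNReal.ofReal (inWeight s b x) * V x ^ 2) := by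
  obtain ⟨C, hC, hbound⟩ := (isAdmissible_symKernel (show 1 < 1 + δ by linarith) hb1 hδ0).bound
  set L := ENNReal.ofReal (8 * (864 + 108 * 3 ^ (2 * θ - 1/2 + δ))) with hL
  refine ⟨c ^ 2 * L * C, by simp only [hL]; finiteness, fun Q U V hQ hU hV hle hfin => ?_⟩
  set A : Freq → ENNReal := fun x => ENNReal.ofReal (outWeight s' θ x) * Q (-x) ^ 2 with hA
  set B : Freq → ENNReal := fun x => ENNReal.ofReal (inWeight s b x) * U x ^ 2 with hB
  set D : Freq → ENNReal := fun x => ENNReal.ofReal (inWeight s b x) * V x ^ 2 with hD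
  have hAm : Measurable A := by fun_prop
  have hBm : Measurable B := by fun_prop
  have hDm : Measurable D := by fun_prop
  set I := ∫⁻ x, ENNReal.ofReal (outWeight s' θ x) * Q x ^ 2 with hI
  have hAI : ∫⁻ x, A x = I := by
    rw [hI, ← lintegral_neg_eq_self (μ := (volume : Measure Freq))]
    simp only [hA, outWeight_neg, neg_neg]
  set Φ : Freq → Freq → Freq → ENNReal := fun x y z =>
    ENNReal.ofReal (outWeight s' θ x) * Q (-x) *
      (ENNReal.ofReal |planeCross y.2 z.2| * (U y * V z)) with hΦ
  have hΦm : Measurable fun p : Freq × Freq × Freq => Φ p.1 p.2.1 p.2.2 := by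
    unfold Φ planeCross; fun_prop
  have hIΦ : I ≤ c * zeroSumLIntegral Φ := by
    have hrot : ∫⁻ x, ∫⁻ y, Φ x y (-x - y) = zeroSumLIntegral Φ := by
      rw [← zeroSumLIntegral_swap_right hΦm]
      refine Eq.trans ?_ (zeroSumLIntegral_swap_left (Φ := fun x y z => Φ x z y)
        (hΦm.comp (f := fun p : Freq × Freq × Freq => (p.1, p.2.2, p.2.1)) (by fun_prop)))
      rfl
    rw [← hrot, hI, ← lintegral_neg_eq_self (μ := (volume : Measure Freq)),
      ← lintegral_const_mul' _ _ hc]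
    refine lintegral_mono fun x => ?_
    simp only [outWeight_neg, hΦ]
    rw [lintegral_const_mul _ (by unfold planeCross; fun_prop), sq, ← mul_assoc, mul_left_comm]
    gcongr
    exact hle (-x)
  have hΦκ : ∀ x y, Φ (-x - y) x y ≤ (L * (symKernel (1 + δ) b δ (-x - y) x y *
      (A (-x - y) * B x * D y))) ^ (1/2 : ℝ) := fun x y => by
    set w := -x - y with hw
    have hroot : Φ w x y = (Φ w x y ^ 2) ^ (1/2 : ℝ) := by
      rw [← ENNReal.rpow_two, ← ENNReal.rpow_mul]; norm_num
    have hκ := nullKernel_le_symKernel hθ hθ' hs0 hs hs' hδ0.le hδ hδ' hb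
      (show w + x + y = 0 by rw [hw]; abel)
    have hw' : ENNReal.ofReal (outWeight s' θ w) * ENNReal.ofReal |planeCross x.2 y.2| ^ 2 ≤
        L * symKernel (1 + δ) b δ w x y *
          (ENNReal.ofReal (inWeight s b x) * ENNReal.ofReal (inWeight s b y)) := by
      have hix := inWeight_pos s b x
      calc _ = ENNReal.ofReal (planeCross x.2 y.2 ^ 2 * outWeight s' θ w) := by
            rw [← ENNReal.ofReal_pow (abs_nonneg _), sq_abs, mul_comm,
              ENNReal.ofReal_mul (sq_nonneg _)]
        _ ≤ ENNReal.ofReal (8 * (planeCross x.2 y.2 ^ 2 *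
              (ellipticWeight s s' (planeNorm w.2) (planeNorm x.2) (planeNorm y.2) *
              hyperbolicWeight θ b |modulation w| |modulation x| |modulation y|)) *
              (inWeight s b x * inWeight s b y)) := by
            refine ENNReal.ofReal_le_ofReal ?_
            have := mul_le_mul_of_nonneg_left (outWeight_le (θ := θ) (b := b) (by linarith) hs hs0'
              hs' w x y) (sq_nonneg (planeCross x.2 y.2))
            linarith
        _ = 8 * nullKernel s s' θ b w x y *
              (ENNReal.ofReal (inWeight s b x) * ENNReal.ofReal (inWeight s b y)) := by
            rw [nullKernel, ENNReal.ofReal_mul' (mul_pos hix (inWeight_pos s b y)).le,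
              ENNReal.ofReal_mul (by norm_num), ENNReal.ofReal_mul hix.le, ENNReal.ofReal_ofNat]
        _ ≤ 8 * (ENNReal.ofReal (864 + 108 * 3 ^ (2 * θ - 1/2 + δ)) *
              symKernel (1 + δ) b δ w x y) *
              (ENNReal.ofReal (inWeight s b x) * ENNReal.ofReal (inWeight s b y)) := by gcongr
        _ = _ := by
            rw [hL, ENNReal.ofReal_mul (by norm_num), ENNReal.ofReal_ofNat]; ring
    rw [hroot]
    gcongr
    calc Φ w x y ^ 2 = ENNReal.ofReal (outWeight s' θ w) *
          (ENNReal.ofReal (outWeight s' θ w) * ENNReal.ofReal |planeCross x.2 y.2| ^ 2) *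
          (Q (-w) ^ 2 * (U x ^ 2 * V y ^ 2)) := by simp only [hΦ]; ring
      _ ≤ ENNReal.ofReal (outWeight s' θ w) * (L * symKernel (1 + δ) b δ w x y *
          (ENNReal.ofReal (inWeight s b x) * ENNReal.ofReal (inWeight s b y))) *
          (Q (-w) ^ 2 * (U x ^ 2 * V y ^ 2)) := by gcongr
      _ = _ := by simp only [hA, hB, hD]; ring
  have hI2 : I ^ 2 ≤ I * (c ^ 2 * L * C * ((∫⁻ x, B x) * ∫⁻ x, D x)) := by
    calc I ^ 2 ≤ (c * zeroSumLIntegral Φ) ^ 2 := pow_le_pow_left' hIΦ 2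
      _ ≤ (c * (L ^ (1/2 : ℝ) * zeroSumLIntegral fun x y z =>
            (symKernel (1 + δ) b δ x y z * (A x * B y * D z)) ^ (1/2 : ℝ))) ^ 2 := by
          gcongr
          unfold zeroSumLIntegral
          have hL' : L ^ (1/2 : ℝ) ≠ ⊤ := by
            simp only [hL]; finiteness
          rw [← lintegral_const_mul' _ _ hL']
          refine lintegral_mono fun x => ?_
          rw [← lintegral_const_mul' _ _ hL']
          refine lintegral_mono fun y => ?_
          rw [← ENNReal.mul_rpow_of_nonneg _ _ (by norm_num)]
          exact hΦκ x y
      _ = c ^ 2 * (L ^ (1/2 : ℝ)) ^ 2 * zeroSumLIntegral (fun x y z =>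
            (symKernel (1 + δ) b δ x y z * (A x * B y * D z)) ^ (1/2 : ℝ)) ^ 2 := by ring
      _ ≤ c ^ 2 * L * (C * ((∫⁻ x, A x) * (∫⁻ x, B x) * ∫⁻ x, D x)) := by
          gcongr
          · rw [← ENNReal.rpow_two, ← ENNReal.rpow_mul]; norm_num
          · exact hbound A B D hAm hBm hDm
      _ = _ := by rw [hAI]; ring
  rcases eq_or_ne I 0 with h0 | h0
  · rw [h0]; exact zero_le
  · rw [sq] at hI2
    exact (ENNReal.mul_le_mul_iff_right h0 hfin).1 hI2

/-! ### The Fourier transform of the null form -/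

open SchwartzMap in
lemma fourier_mul_schwartz (f g : SchwartzMap SpaceTime ℂ) (ζ : SpaceTime) :
    𝓕 (fun x => f x * g x) ζ = ∫ η, 𝓕 (fun x => f x) η * 𝓕 (fun x => g x) (ζ - η) := by
  set B := ContinuousLinearMap.mul ℂ ℂ
  have h : pairing B f g = 𝓕⁻ (SchwartzMap.convolution B (𝓕 f) (𝓕 g)) := by
    ext x
    rw [SchwartzMap.fourierInv_coe, Real.fourierInv_eq_fourier_neg, ← SchwartzMap.fourier_coe,
      SchwartzMap.fourier_convolution]
    simp only [pairing_apply_apply]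
    have key : ∀ k : SchwartzMap SpaceTime ℂ, 𝓕 (𝓕 k) (-x) = k x := fun k => by
      rw [SchwartzMap.fourier_coe, ← Real.fourierInv_eq_fourier_neg, ← SchwartzMap.fourierInv_coe,
        FourierTransform.fourierInv_fourier_eq]
    rw [key, key]
  have h1 : (fun x => f x * g x) = ⇑(pairing B f g) := by
    ext x
    simp [pairing_apply_apply, B]
  rw [h1, ← SchwartzMap.fourier_coe, h, FourierTransform.fourier_fourierInv_eq,
    SchwartzMap.convolution_apply,
    convolution_def]
  rfl

lemma integrable_fourier_mul_fourier_sub (f g : SchwartzMap SpaceTime ℂ) (ζ : SpaceTime) :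
    Integrable fun η => 𝓕 (fun x => f x) η * 𝓕 (fun x => g x) (ζ - η) := by
  change Integrable fun η => (𝓕 (f : SpaceTime → ℂ)) η * (𝓕 (g : SpaceTime → ℂ)) (ζ - η)
  rw [← SchwartzMap.fourier_coe, ← SchwartzMap.fourier_coe]
  obtain ⟨C, hC⟩ : ∃ C, ∀ x, ‖(𝓕 g) x‖ ≤ C := by
    obtain ⟨C, -, hC⟩ := (𝓕 g).decay 0 0
    exact ⟨C, fun x => by simpa using hC x⟩
  exact (𝓕 f).integrable.mul_bdd (c := C)
    ((𝓕 g).continuous.comp (by fun_prop)).aestronglyMeasurable (by simp [hC])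

open LineDeriv in
lemma fourier_pd (j : Fin 3) (f : SchwartzMap SpaceTime ℂ) (ζ : SpaceTime) :
    𝓕 (pd j fun x => f x) ζ = 2 * π * Complex.I * ζ j * 𝓕 (fun x => f x) ζ := by
  have h : (pd j fun x => f x) =
      ⇑(∂_{(EuclideanSpace.single j (1:ℝ) : SpaceTime)} f : SchwartzMap SpaceTime ℂ) := by
    ext x
    rw [SchwartzMap.lineDerivOp_apply_eq_fderiv]
    rfl
  rw [h, ← SchwartzMap.fourier_coe, SchwartzMap.fourier_lineDerivOp_eq, smul_apply,
    SchwartzMap.smulLeftCLM_apply_apply (by fun_prop), SchwartzMap.fourier_coe]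
  simp [EuclideanSpace.inner_single_right]
  ring

/-- The symbol of the null form. -/
def nullSymbol (j k : Fin 3) (ζ η : SpaceTime) : ℝ := ζ j * η k - ζ k * η j

open LineDeriv in
lemma exists_schwartz_eq_pd (j : Fin 3) (f : SchwartzMap SpaceTime ℂ) :
    ∃ g : SchwartzMap SpaceTime ℂ, (pd j fun x => f x) = fun x => g x :=
  ⟨∂_{(EuclideanSpace.single j (1:ℝ) : SpaceTime)} f, by
    ext x
    rw [SchwartzMap.lineDerivOp_apply_eq_fderiv]
    rfl⟩

lemma exists_schwartz_eq_nullForm (j k : Fin 3) (u v : SchwartzMap SpaceTime ℂ) :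
    ∃ w : SchwartzMap SpaceTime ℂ, nullForm j k (fun x => u x) (fun x => v x) = w := by
  obtain ⟨uj, huj⟩ := exists_schwartz_eq_pd j u
  obtain ⟨uk, huk⟩ := exists_schwartz_eq_pd k u
  obtain ⟨vj, hvj⟩ := exists_schwartz_eq_pd j v
  obtain ⟨vk, hvk⟩ := exists_schwartz_eq_pd k v
  set B := ContinuousLinearMap.mul ℂ ℂ
  refine ⟨SchwartzMap.pairing B uj vk - SchwartzMap.pairing B uk vj, ?_⟩
  ext x
  simp [nullForm, huj, huk, hvj, hvk, B, SchwartzMap.pairing_apply_apply]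

lemma fourier_nullForm (j k : Fin 3) (u v : SchwartzMap SpaceTime ℂ) (ζ : SpaceTime) :
    𝓕 (nullForm j k (fun x => u x) (fun x => v x)) ζ =
      ∫ η, (-(4 * π ^ 2) * nullSymbol j k η (ζ - η) : ℝ) *
        (𝓕 (fun x => u x) η * 𝓕 (fun x => v x) (ζ - η)) := by
  obtain ⟨uj, huj⟩ := exists_schwartz_eq_pd j u
  obtain ⟨uk, huk⟩ := exists_schwartz_eq_pd k u
  obtain ⟨vj, hvj⟩ := exists_schwartz_eq_pd j v
  obtain ⟨vk, hvk⟩ := exists_schwartz_eq_pd k v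
  have e : nullForm j k (fun x => u x) (fun x => v x) =
      (fun x => uj x * vk x) - fun x => uk x * vj x := by
    ext x
    simp only [nullForm, huj, huk, hvj, hvk, Pi.sub_apply]
  have hInt : ∀ f g : SchwartzMap SpaceTime ℂ, Integrable fun x => f x * g x := fun f g => by
    obtain ⟨C, -, hC⟩ := g.decay 0 0
    exact f.integrable.mul_bdd (c := C) g.continuous.aestronglyMeasurable
      (ae_of_all _ fun x => by simpa using hC x)
  have hsub : 𝓕 ((fun x => uj x * vk x) - fun x => uk x * vj x) ζ =
      𝓕 (fun x => uj x * vk x) ζ - 𝓕 (fun x => uk x * vj x) ζ := by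
    simp only [Real.fourier_eq]
    rw [← integral_sub]
    · simp [smul_sub]
    · exact (Real.fourierIntegral_convergent_iff ζ).2 (hInt uj vk)
    · exact (Real.fourierIntegral_convergent_iff ζ).2 (hInt uk vj)
  rw [e, hsub, fourier_mul_schwartz, fourier_mul_schwartz,
    ← integral_sub (integrable_fourier_mul_fourier_sub _ _ _)
      (integrable_fourier_mul_fourier_sub _ _ _)]
  refine integral_congr_ae (ae_of_all _ fun η => ?_)
  simp only [← huj, ← huk, ← hvj, ← hvk, fourier_pd, nullSymbol]
  push_cast
  linear_combination (4 * π ^ 2 * (η j * (ζ - η) k - η k * (ζ - η) j) * (𝓕 (fun x => u x) η *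
    𝓕 (fun x => v x) (ζ - η))) * Complex.I_sq

lemma abs_nullSymbol_le {j k : Fin 3} (hj : j = 1 ∨ j = 2) (hk : k = 1 ∨ k = 2) (ζ η : SpaceTime) :
    |nullSymbol j k ζ η| ≤ |planeCross (ζ 1, ζ 2) (η 1, η 2)| := by
  unfold nullSymbol planeCross
  rcases hj with rfl | rfl <;> rcases hk with rfl | rfl
  · simp
  · exact le_rfl
  · rw [abs_sub_comm]
  · simp

lemma enorm_fourier_nullForm_le {j k : Fin 3} (hj : j = 1 ∨ j = 2) (hk : k = 1 ∨ k = 2)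
    (u v : SchwartzMap SpaceTime ℂ) (ζ : SpaceTime) :
    ‖𝓕 (nullForm j k (fun x => u x) (fun x => v x)) ζ‖ₑ ≤ ENNReal.ofReal (4 * π ^ 2) *
      ∫⁻ η, ENNReal.ofReal |planeCross (η 1, η 2) ((ζ - η) 1, (ζ - η) 2)| *
        (‖𝓕 (fun x => u x) η‖ₑ * ‖𝓕 (fun x => v x) (ζ - η)‖ₑ) := by
  rw [fourier_nullForm, ← lintegral_const_mul' _ _ (by finiteness)]
  refine (enorm_integral_le_lintegral_enorm _).trans (lintegral_mono fun η => ?_)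
  rw [enorm_mul, enorm_mul, ← mul_assoc (ENNReal.ofReal (4 * π ^ 2))]
  refine mul_le_mul_left ?_ _
  rw [← ENNReal.ofReal_mul (by positivity), ← ofReal_norm]
  refine ENNReal.ofReal_le_ofReal ?_
  rw [Complex.norm_real, norm_mul, norm_neg, Real.norm_of_nonneg (by positivity), Real.norm_eq_abs]
  exact mul_le_mul_of_nonneg_left (abs_nullSymbol_le hj hk _ _) (by positivity)

/-! ### From space-time to frequency coordinates -/

/-- Space-time frequencies as pairs `(τ, ξ)`. -/
def toFreq (ζ : SpaceTime) : Freq := (ζ 0, (ζ 1, ζ 2))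

/-- The inverse of `toFreq`. -/
def ofFreq (p : Freq) : SpaceTime := !₂[p.1, p.2.1, p.2.2]

@[simp]
lemma ofFreq_toFreq (ζ : SpaceTime) : ofFreq (toFreq ζ) = ζ := by
  ext i; fin_cases i <;> rfl

lemma ofFreq_sub (x y : Freq) : ofFreq (x - y) = ofFreq x - ofFreq y := by
  ext i; fin_cases i <;> rfl

@[fun_prop]
lemma continuous_ofFreq : Continuous ofFreq := by
  unfold ofFreq
  refine (PiLp.continuous_toLp 2 _).comp (continuous_pi fun i => ?_)
  fin_cases i <;> simp <;> fun_prop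

lemma measurePreserving_toFreq : MeasurePreserving toFreq := by
  have h1 := EuclideanSpace.volume_preserving_symm_measurableEquiv_toLp (Fin 3)
  have h2 := volume_preserving_piFinSuccAbove (fun _ : Fin 3 => ℝ) 0
  have h3 := (MeasurePreserving.id (volume : Measure ℝ)).prod (volume_preserving_finTwoArrow ℝ)
  exact (h3.comp (h2.comp h1) :)

lemma lintegral_spaceTime {H : SpaceTime → ENNReal} (hH : Measurable H) :
    ∫⁻ ζ, H ζ = ∫⁻ x, H (ofFreq x) := by
  simpa using measurePreserving_toFreq.lintegral_comp (hH.comp continuous_ofFreq.measurable)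

@[fun_prop]
lemma continuous_spFreq : Continuous spFreq := by
  unfold spFreq; fun_prop

lemma integrable_waveNorm {s b : ℝ} (hs1 : s ≤ 1) (hb : 0 ≤ b) (hb1 : b ≤ 1)
    (f : SchwartzMap SpaceTime ℂ) :
    Integrable fun ζ : SpaceTime => (1 + spFreq ζ ^ 2) ^ s * (1 + |(|ζ 0| - spFreq ζ)|) ^ (2 * b) *
      ‖𝓕 (fun x => f x) ζ‖ ^ 2 := by
  change Integrable fun ζ : SpaceTime => (1 + spFreq ζ ^ 2) ^ s *
    (1 + |(|ζ 0| - spFreq ζ)|) ^ (2 * b) * ‖𝓕 (f : SpaceTime → ℂ) ζ‖ ^ 2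
  rw [← SchwartzMap.fourier_coe]
  set F := 𝓕 f
  set C := 2 ^ 4 * ((Finset.Iic (4, 0)).sup fun m => SchwartzMap.seminorm ℝ m.1 m.2) F
  have hC : ∀ ζ : SpaceTime, (1 + ‖ζ‖) ^ 4 * ‖F ζ‖ ≤ C := fun ζ => by
    simpa using SchwartzMap.one_add_le_sup_seminorm_apply (𝕜 := ℝ) (m := (4, 0)) (k := 4) (n := 0)
      le_rfl le_rfl F ζ
  refine (F.integrable.norm.const_mul C).mono' ?_ (ae_of_all _ fun ζ => ?_)
  · have : Measurable F := F.continuous.measurable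
    have := continuous_spFreq.measurable
    exact Measurable.aestronglyMeasurable (by fun_prop)
  have hn : ‖ζ‖ ^ 2 = ζ 0 ^ 2 + (ζ 1 ^ 2 + ζ 2 ^ 2) := by
    rw [EuclideanSpace.norm_sq_eq, Fin.sum_univ_three]
    simp only [Real.norm_eq_abs, sq_abs]
    ring
  have hsp0 : 0 ≤ spFreq ζ := Real.sqrt_nonneg _
  have hsp : spFreq ζ ≤ ‖ζ‖ := by
    refine Real.sqrt_le_iff.2 ⟨norm_nonneg _, ?_⟩
    nlinarith [sq_nonneg (ζ 0)]
  have ht : |ζ 0| ≤ ‖ζ‖ := by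
    refine abs_le_of_sq_le_sq ?_ (norm_nonneg _)
    nlinarith [sq_nonneg (ζ 1), sq_nonneg (ζ 2)]
  have hm : |(|ζ 0| - spFreq ζ)| ≤ ‖ζ‖ := abs_le.2 ⟨by linarith [abs_nonneg (ζ 0)], by linarith⟩
  have hN := norm_nonneg ζ
  have h1 : (1 + spFreq ζ ^ 2) ^ s ≤ (1 + ‖ζ‖) ^ 2 := by
    calc (1 + spFreq ζ ^ 2) ^ s ≤ (1 + spFreq ζ ^ 2) ^ (1 : ℝ) :=
          Real.rpow_le_rpow_of_exponent_le (by nlinarith) hs1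
      _ ≤ _ := by rw [Real.rpow_one]; nlinarith
  have h2 : (1 + |(|ζ 0| - spFreq ζ)|) ^ (2 * b) ≤ (1 + ‖ζ‖) ^ 2 := by
    calc (1 + |(|ζ 0| - spFreq ζ)|) ^ (2 * b) ≤ (1 + ‖ζ‖) ^ (2 * b) := by gcongr
      _ ≤ (1 + ‖ζ‖) ^ (2 : ℝ) := Real.rpow_le_rpow_of_exponent_le (by linarith) (by linarith)
      _ = _ := Real.rpow_two _
  rw [Real.norm_of_nonneg (by positivity)]
  calc _ ≤ (1 + ‖ζ‖) ^ 2 * (1 + ‖ζ‖) ^ 2 * ‖F ζ‖ ^ 2 := by gcongr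
    _ = (1 + ‖ζ‖) ^ 4 * ‖F ζ‖ * ‖F ζ‖ := by ring
    _ ≤ C * ‖F ζ‖ := by
        have := hC ζ
        gcongr

lemma measurable_fourier (f : SchwartzMap SpaceTime ℂ) : Measurable (𝓕 fun y => f y) := by
  have h := (𝓕 f).continuous
  rw [SchwartzMap.fourier_coe] at h
  exact h.measurable

lemma measurable_fourier_comp_ofFreq (f : SchwartzMap SpaceTime ℂ) :
    Measurable fun x => ‖𝓕 (fun y => f y) (ofFreq x)‖ₑ :=
  ((measurable_fourier f).comp continuous_ofFreq.measurable).enorm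

lemma lintegral_inWeight_eq {s b : ℝ} (hs1 : s ≤ 1) (hb : 0 ≤ b) (hb1 : b ≤ 1)
    (f : SchwartzMap SpaceTime ℂ) :
    ∫⁻ x, ENNReal.ofReal (inWeight s (2 * b) x) * ‖𝓕 (fun y => f y) (ofFreq x)‖ₑ ^ 2 =
      ENNReal.ofReal (∫ ζ : SpaceTime, (1 + spFreq ζ ^ 2) ^ s *
        (1 + |(|ζ 0| - spFreq ζ)|) ^ (2 * b) * ‖𝓕 (fun y => f y) ζ‖ ^ 2) := by
  have hi := integrable_waveNorm hs1 hb hb1 f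
  rw [ofReal_integral_eq_lintegral_ofReal hi (ae_of_all _ fun ζ => by positivity),
    ← measurePreserving_toFreq.lintegral_comp]
  · refine lintegral_congr fun ζ => ?_
    rw [ofFreq_toFreq, ← ofReal_norm, ← ENNReal.ofReal_pow (norm_nonneg _),
      ← ENNReal.ofReal_mul (inWeight_pos _ _ _).le]
    rfl
  · have := measurable_fourier_comp_ofFreq f
    fun_prop

lemma enorm_fourier_nullForm_ofFreq_le {j k : Fin 3} (hj : j = 1 ∨ j = 2) (hk : k = 1 ∨ k = 2)
    (u v : SchwartzMap SpaceTime ℂ) (x : Freq) :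
    ‖𝓕 (nullForm j k (fun y => u y) (fun y => v y)) (ofFreq x)‖ₑ ≤
      ENNReal.ofReal (4 * π ^ 2) * ∫⁻ y, ENNReal.ofReal |planeCross y.2 (x - y).2| *
        (‖𝓕 (fun z => u z) (ofFreq y)‖ₑ * ‖𝓕 (fun z => v z) (ofFreq (x - y))‖ₑ) := by
  refine (enorm_fourier_nullForm_le hj hk u v (ofFreq x)).trans_eq ?_
  rw [lintegral_spaceTime]
  · simp_rw [← ofFreq_sub]
    rfl
  · have hu := measurable_fourier u
    have hv := measurable_fourier v
    unfold planeCross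
    fun_prop

/-- The estimate `‖D^{-1}Q_{jk}(u,v)‖_{H^{s'-1, θ₁-1+ε}} ≲ ‖u‖_{H^{s,θ₀}} ‖v‖_{H^{s,θ₀}}`,
where `D^{-1}` is the spatial Fourier multiplier with symbol `|ξ|^{-1}`. -/
theorem nullform_DinvQ_estimate (s s' θ₀ θ₁ : ℝ)
    (hs1 : 1/4 < s') (hs2 : s' ≤ 1) (hs3 : 1/2 < s) (hs4 : s ≤ 1)
    (hs5 : max (3/2 - 2 * s) (s/2 - 1/8) < s') (hs6 : s' < 4 * s - 3/2)
    (hθ0 : 1/2 < θ₀) (hθ0b : θ₀ < 3/4)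
    (hθ1 : max (1/2) (1 - s') < θ₁)
    (hθ1b : θ₁ < min (3/4) (min (4 * s - s' - 1) (2 * s - 1/2))) :
    ∃ ε₀ > 0, ∀ ε : ℝ, 0 < ε → ε ≤ ε₀ → ∃ C > 0,
      ∀ (u v : SchwartzMap SpaceTime ℂ) (j k : Fin 3),
        (j = 1 ∨ j = 2) → (k = 1 ∨ k = 2) →
        (∫ ζ : SpaceTime, (spFreq ζ) ^ (-2 : ℝ) * (1 + (spFreq ζ) ^ 2) ^ (s' - 1) *
            (1 + |(|ζ 0| - spFreq ζ)|) ^ (2 * (θ₁ - 1 + ε)) *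
            ‖𝓕 (nullForm j k (fun x => u x) (fun x => v x)) ζ‖ ^ 2) ^ (1/2 : ℝ) ≤
          C * waveNorm s θ₀ (fun x => u x) * waveNorm s θ₀ (fun x => v x) := by
  obtain ⟨hθ_half, -⟩ := max_lt_iff.1 hθ1
  obtain ⟨hθ34, hθs, -⟩ := by simpa only [lt_min_iff] using hθ1b
  obtain ⟨ε₀, hε₀, hε₀lt⟩ := exists_between
    (show 0 < min (3/4 - θ₁) (4 * s - s' - 1 - θ₁) from lt_min (by linarith) (by linarith))
  obtain ⟨h34, h4s⟩ := lt_min_iff.1 hε₀lt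
  refine ⟨ε₀, hε₀, fun ε hε hεε₀ => ?_⟩
  obtain ⟨δ, hδ0, hδlt⟩ := exists_between
    (show 0 < min (4 * s - (2 * s' + 1/2)) (4 * s - (s' + (θ₁ + ε) + 1)) from
      lt_min (by linarith) (by linarith))
  obtain ⟨hδ1, hδ2⟩ := lt_min_iff.1 hδlt
  obtain ⟨C, hC, hest⟩ := lintegral_outWeight_le (s := s) (s' := s') (θ := θ₁ + ε) (δ := δ)
    (b := 2 * θ₀) (by linarith) (by linarith) hs3.le hs4 (by linarith) hs2 hδ0 (by linarith)
    (by linarith) (by linarith) (by linarith) (c := ENNReal.ofReal (4 * π ^ 2))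
    ENNReal.ofReal_ne_top
  refine ⟨C.toReal ^ (1/2 : ℝ) + 1, by positivity, fun u v j k hj hk => ?_⟩
  have hwave : ∀ f : SchwartzMap SpaceTime ℂ, 0 ≤ ∫ ζ : SpaceTime, (1 + spFreq ζ ^ 2) ^ s *
      (1 + |(|ζ 0| - spFreq ζ)|) ^ (2 * θ₀) * ‖𝓕 (fun y => f y) ζ‖ ^ 2 := fun f =>
    integral_nonneg fun ζ => by positivity
  by_cases hInt : Integrable fun ζ : SpaceTime =>
      (spFreq ζ) ^ (-2 : ℝ) * (1 + (spFreq ζ) ^ 2) ^ (s' - 1) *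
        (1 + |(|ζ 0| - spFreq ζ)|) ^ (2 * (θ₁ - 1 + ε)) *
        ‖𝓕 (nullForm j k (fun x => u x) (fun x => v x)) ζ‖ ^ 2
  swap
  · rw [integral_undef hInt, Real.zero_rpow (by norm_num)]
    have := Real.rpow_nonneg (hwave u) (1/2)
    have := Real.rpow_nonneg (hwave v) (1/2)
    unfold waveNorm
    positivity
  have hnonneg : ∀ ζ : SpaceTime, 0 ≤ (spFreq ζ) ^ (-2 : ℝ) * (1 + (spFreq ζ) ^ 2) ^ (s' - 1) *
        (1 + |(|ζ 0| - spFreq ζ)|) ^ (2 * (θ₁ - 1 + ε)) *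
        ‖𝓕 (nullForm j k (fun x => u x) (fun x => v x)) ζ‖ ^ 2 := fun ζ => by
    have : 0 ≤ spFreq ζ := Real.sqrt_nonneg _
    positivity
  set Q : Freq → ENNReal := fun x =>
    ‖𝓕 (nullForm j k (fun x => u x) (fun x => v x)) (ofFreq x)‖ₑ with hQ
  have hQm : Measurable Q := by
    obtain ⟨w, hw⟩ := exists_schwartz_eq_nullForm j k u v
    simp only [hQ, hw]
    exact measurable_fourier_comp_ofFreq w
  have hleft : ENNReal.ofReal (∫ ζ : SpaceTime,
      (spFreq ζ) ^ (-2 : ℝ) * (1 + (spFreq ζ) ^ 2) ^ (s' - 1) *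
        (1 + |(|ζ 0| - spFreq ζ)|) ^ (2 * (θ₁ - 1 + ε)) *
        ‖𝓕 (nullForm j k (fun x => u x) (fun x => v x)) ζ‖ ^ 2) =
      ∫⁻ x, ENNReal.ofReal (outWeight s' (θ₁ + ε) x) * Q x ^ 2 := by
    rw [ofReal_integral_eq_lintegral_ofReal hInt (ae_of_all _ hnonneg),
      ← measurePreserving_toFreq.lintegral_comp]
    · refine lintegral_congr fun ζ => ?_
      simp only [hQ]
      rw [ofFreq_toFreq, ← ofReal_norm, ← ENNReal.ofReal_pow (norm_nonneg _),
        ← ENNReal.ofReal_mul (outWeight_nonneg _ _ _), outWeight,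
        show θ₁ + ε - 1 = θ₁ - 1 + ε by ring]
      rfl
    · have := measurable_outWeight s' (θ₁ + ε)
      fun_prop
  have hbound := hest Q _ _ hQm (measurable_fourier_comp_ofFreq u)
    (measurable_fourier_comp_ofFreq v) (enorm_fourier_nullForm_ofFreq_le hj hk u v)
    (hleft ▸ ENNReal.ofReal_ne_top)
  rw [← hleft, lintegral_inWeight_eq hs4 (by linarith) (by linarith),
    lintegral_inWeight_eq hs4 (by linarith) (by linarith), ← ENNReal.ofReal_toReal hC,
    ← ENNReal.ofReal_mul (hwave u), ← ENNReal.ofReal_mul ENNReal.toReal_nonneg,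
    ENNReal.ofReal_le_ofReal_iff (mul_nonneg ENNReal.toReal_nonneg
      (mul_nonneg (hwave u) (hwave v)))] at hbound
  have hroot := Real.rpow_le_rpow (integral_nonneg hnonneg) hbound
    (show (0 : ℝ) ≤ 1/2 by norm_num)
  rw [Real.mul_rpow ENNReal.toReal_nonneg (mul_nonneg (hwave u) (hwave v)),
    Real.mul_rpow (hwave u) (hwave v), ← mul_assoc] at hroot
  refine hroot.trans ?_
  have hu := Real.rpow_nonneg (hwave u) (1/2)
  have hv := Real.rpow_nonneg (hwave v) (1/2)
  unfold waveNorm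
  gcongr
  linarith

end
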